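/- arXiv:1909.04281 — 2 statements merged into one kernel-verified Lean document; each statement's English description precedes it below -/
import Mathlib

section
/- Define the Wilf number 𝖶(P_n) = k·(F(P_n) − g(P_n)) − (F(P_n) + 1). There exist functions c₂, c₁, c₀ : ℤ → ℚ, each periodic with period r_k, such that 𝖶(P_n) = c₂(n)·n² + c₁(n)·n + c₀(n) for all integers n > W·R²; moreover, if k ≥ 3, then there exists N such that 𝖶(P_n) > 0 for all integers n > N. -/
open Finset

set_option linter.unusedSectionVars false

lemma exists_sum_mul_eq_gcd {ι : Type*} (t : Finset ι) (f : ι → ℕ) :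
    ∃ y : ι → ℤ, ∑ i ∈ t, y i * f i = (t.gcd f : ℕ) := by
  classical
  induction t using Finset.induction_on with
  | empty => exact ⟨0, by simp⟩
  | insert a t ha ih =>
    obtain ⟨y, hy⟩ := ih
    refine ⟨fun i => if i = a then Nat.gcdA (f a) (t.gcd f) else
      Nat.gcdB (f a) (t.gcd f) * y i, ?_⟩
    rw [Finset.sum_insert ha, Finset.gcd_insert]
    dsimp only
    rw [if_pos rfl, show gcd (f a) (t.gcd f) = Nat.gcd (f a) (t.gcd f) from rfl,
      Nat.gcd_eq_gcd_ab, ← hy, Finset.sum_mul, mul_comm]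
    congr 1
    refine Finset.sum_congr rfl fun i hi => ?_
    rw [if_neg (ne_of_mem_of_not_mem hi ha)]
    ring

/-- A function that is quadratic along arithmetic progressions of difference `ρ` is
quasi-quadratic. -/
lemma exists_quasiquadratic {f : ℕ → ℚ} {ρ N : ℕ} (hρ : 1 ≤ ρ)
    (hf : ∀ n, N < n → ∃ A B C : ℚ, ∀ j : ℕ, f (n + ρ * j) = A + B * j + C * j ^ 2) :
    ∃ c₂ c₁ c₀ : ℤ → ℚ, (∀ t : ℤ, c₂ (t + ρ) = c₂ t) ∧ (∀ t : ℤ, c₁ (t + ρ) = c₁ t) ∧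
      (∀ t : ℤ, c₀ (t + ρ) = c₀ t) ∧
      ∀ n : ℕ, N < n → f n = c₂ n * (n : ℚ) ^ 2 + c₁ n * n + c₀ n := by
  choose! A B C h using hf
  let b : ℤ → ℕ := fun t => N + 1 + ((t - (N + 1)) % ρ).toNat
  have hb : ∀ t, b (t + ρ) = b t := fun t => by
    simp only [b]
    rw [show t + ρ - (N + 1) = t - (N + 1) + ρ by ring, Int.add_emod_right]
  refine ⟨fun t => C (b t) / ρ ^ 2, fun t => B (b t) / ρ - 2 * C (b t) * b t / ρ ^ 2,
    fun t => A (b t) - B (b t) * b t / ρ + C (b t) * b t ^ 2 / ρ ^ 2,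
    fun t => by simp only [hb], fun t => by simp only [hb], fun t => by simp only [hb],
    fun n hn => ?_⟩
  obtain ⟨l, rfl⟩ : ∃ l, n = N + 1 + l := ⟨n - (N + 1), by omega⟩
  have hbn : b (N + 1 + l : ℕ) = N + 1 + l % ρ := by
    simp only [b]
    rw [show ((N + 1 + l : ℕ) : ℤ) - (N + 1) = l by push_cast; ring, ← Int.natCast_mod,
      Int.toNat_natCast]
  have hl : N + 1 + l = N + 1 + l % ρ + ρ * (l / ρ) := by
    have := Nat.mod_add_div l ρ
    omega
  have hρ0 : (ρ : ℚ) ≠ 0 := by positivity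
  have h1 := h (N + 1 + l % ρ) (by omega) (l / ρ)
  rw [← hl] at h1
  have hl' := congrArg (Nat.cast : ℕ → ℚ) hl
  rw [Nat.cast_add _ (ρ * _), Nat.cast_mul] at hl'
  simp only [hbn]
  rw [h1, hl']
  field_simp
  ring

/-- The weighted total `∑ i, z i * f i` of a multiplicity vector `z`. -/
def wsum {ι : Type*} [Fintype ι] (f z : ι → ℕ) : ℕ := ∑ i, z i * f i

section WeightedSums

variable {ι : Type*} [Fintype ι]

lemma wsum_add (f a b : ι → ℕ) : wsum f (a + b) = wsum f a + wsum f b := by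
  simp [wsum, add_mul, Finset.sum_add_distrib]

@[simp] lemma wsum_zero (f : ι → ℕ) : wsum f 0 = 0 := by simp [wsum]

lemma wsum_mono (f : ι → ℕ) {a b : ι → ℕ} (h : a ≤ b) : wsum f a ≤ wsum f b :=
  Finset.sum_le_sum fun i _ => Nat.mul_le_mul_right _ (h i)

lemma wsum_le_mul_size {f : ι → ℕ} {B : ℕ} (hf : ∀ i, f i ≤ B) (a : ι → ℕ) :
    wsum f a ≤ B * wsum 1 a := by
  simp only [wsum, Finset.mul_sum, Pi.one_apply, mul_one]
  exact Finset.sum_le_sum fun i _ => by rw [mul_comm]; exact Nat.mul_le_mul_right _ (hf i)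

lemma size_eq_zero {a : ι → ℕ} : wsum 1 a = 0 ↔ a = 0 := by
  simp [wsum, funext_iff]

/-- A multiplicity vector can be built up one element at a time. -/
lemma exists_chain (N : ℕ) : ∀ v : ι → ℕ, wsum 1 v = N →
    ∃ p : ℕ → ι → ℕ, Monotone p ∧ p N = v ∧ ∀ j ≤ N, wsum 1 (p j) = j := by
  classical
  induction N with
  | zero =>
    intro v hv
    exact ⟨fun _ => v, monotone_const, rfl, fun j hj => by simpa [Nat.le_zero.1 hj] using hv⟩
  | succ N ih =>
    intro v hv
    obtain ⟨i, hi⟩ : ∃ i, v i ≠ 0 := by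
      by_contra! h
      have : v = 0 := funext h
      simp [this] at hv
    have hsingle : (Pi.single i 1 : ι → ℕ) ≤ v := by
      intro j
      by_cases hj : j = i
      · subst hj; simp; omega
      · simp [hj]
    have hsum : v - Pi.single i 1 + Pi.single i 1 = v := tsub_add_cancel_of_le hsingle
    have hone : wsum 1 (Pi.single i 1 : ι → ℕ) = 1 := by simp [wsum]
    have hsize : wsum 1 (v - Pi.single i 1) = N := by
      have := wsum_add 1 (v - Pi.single i 1) (Pi.single i 1)
      rw [hsum, hone, hv] at this
      omega
    obtain ⟨p, hp, hpN, hps⟩ := ih _ hsize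
    refine ⟨fun j => if j ≤ N then p j else v, ?_, by simp, ?_⟩
    · intro j k hjk
      by_cases hk : k ≤ N
      · simpa [hk, hjk.trans hk] using hp hjk
      · by_cases hj : j ≤ N
        · simp only [hj, hk, if_true, if_false]
          exact (hp hj).trans (hpN ▸ tsub_le_self)
        · simp [hj, hk]
    · intro j hj
      by_cases hjN : j ≤ N
      · simpa [hjN] using hps j hjN
      · simp only [hjN, if_false]; omega

lemma exists_sub_of_size {v : ι → ℕ} {N : ℕ} (h : N ≤ wsum 1 v) :
    ∃ u ≤ v, wsum 1 u = N := by
  obtain ⟨p, hp, hpN, hps⟩ := exists_chain _ v rfl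
  exact ⟨p N, hpN ▸ hp h, hps N h⟩

/-- A chain building up `c + a` which passes through `c`. -/
lemma exists_chain_through (c a : ι → ℕ) :
    ∃ p : ℕ → ι → ℕ, Monotone p ∧ p (wsum 1 c) = c ∧ p (wsum 1 (c + a)) = c + a ∧
      ∀ j ≤ wsum 1 (c + a), wsum 1 (p j) = j := by
  obtain ⟨p, hp, hpc, hps⟩ := exists_chain _ c rfl
  obtain ⟨p', hp', hpa, hps'⟩ := exists_chain _ a rfl
  have h0 : p' 0 = 0 := size_eq_zero.1 (hps' 0 (Nat.zero_le _))
  refine ⟨fun j => if j ≤ wsum 1 c then p j else c + p' (j - wsum 1 c), ?_, by simp [hpc], ?_, ?_⟩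
  · intro j k hjk
    by_cases hk : k ≤ wsum 1 c
    · simpa [hk, hjk.trans hk] using hp hjk
    · by_cases hj : j ≤ wsum 1 c
      · simp only [hj, hk, if_true, if_false]
        exact (hp hj).trans (hpc.le.trans le_self_add)
      · simp only [hj, hk, if_false]
        gcongr
        exact hp' (by omega)
  · rw [wsum_add]
    by_cases ha : wsum 1 a = 0
    · simp [size_eq_zero.1 ha, hpc]
    · have : ¬ wsum 1 c + wsum 1 a ≤ wsum 1 c := by omega
      simp [this, hpa]
  · intro j hj
    rw [wsum_add] at hj
    by_cases hjc : j ≤ wsum 1 c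
    · simpa [hjc] using hps j hjc
    · simp only [hjc, if_false, wsum_add]
      rw [hps' _ (by omega)]
      omega

lemma exists_zero_sum_of_lt {f : ι → ℕ} {ρ : ℕ} {u v : ι → ℕ} (huv : u ≤ v)
    (hne : wsum 1 u ≠ wsum 1 v) (h : wsum f u ≡ wsum f v [MOD ρ]) :
    v - u ≠ 0 ∧ ρ ∣ wsum f (v - u) := by
  have hs : u + (v - u) = v := add_tsub_cancel_of_le huv
  constructor
  · intro h0
    rw [h0, add_zero] at hs
    exact hne (by rw [hs])
  · have h1 := wsum_add f u (v - u)
    rw [hs] at h1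
    rw [h1] at h
    have h2 : wsum f u + 0 ≡ wsum f u + wsum f (v - u) [MOD ρ] := h
    exact (Nat.modEq_zero_iff_dvd.1 (Nat.ModEq.add_left_cancel' _ h2).symm)

/-- Pigeonhole on two branches growing out of a common part `c`. -/
lemma exists_zero_sum_branch (f : ι → ℕ) {ρ : ℕ} (hρ : 0 < ρ) (c a b : ι → ℕ)
    (hsize : ρ ≤ wsum 1 c + wsum 1 a + wsum 1 b) :
    (∃ u ≤ c + a, u ≠ 0 ∧ ρ ∣ wsum f u) ∨ (∃ u ≤ c + b, u ≠ 0 ∧ ρ ∣ wsum f u) ∨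
      ∃ a' ≤ a, ∃ b' ≤ b, a' ≠ 0 ∧ b' ≠ 0 ∧ wsum f a' ≡ wsum f b' [MOD ρ] := by
  obtain ⟨p, hp, hpc, hpa, hps⟩ := exists_chain_through c a
  obtain ⟨p', hp', hpc', hpb, hps'⟩ := exists_chain_through c b
  have hca := wsum_add 1 c a
  have hcb := wsum_add 1 c b
  set N := wsum 1 c + wsum 1 a
  let q : ℕ → ι → ℕ := fun j => if j ≤ N then p j else p' (j - wsum 1 a)
  obtain ⟨i, hi, j, hj, hij, heq⟩ : ∃ i ∈ range (ρ + 1), ∃ j ∈ range (ρ + 1), i ≠ j ∧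
      wsum f (q i) % ρ = wsum f (q j) % ρ :=
    Finset.exists_ne_map_eq_of_card_lt_of_maps_to (t := range ρ) (by simp)
      (fun i _ => by simpa using Nat.mod_lt _ hρ)
  wlog hlt : i < j generalizing i j
  · exact this j hj i hi hij.symm heq.symm (by omega)
  rw [Finset.mem_range] at hi hj
  have hmod : wsum f (q i) ≡ wsum f (q j) [MOD ρ] := heq
  by_cases hjN : j ≤ N
  · have hiN : i ≤ N := by omega
    simp only [q, hiN, hjN, if_true] at hmod
    left
    have := exists_zero_sum_of_lt (hp hlt.le)
      (by rw [hps i (by omega), hps j (by omega)]; omega) hmod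
    exact ⟨_, tsub_le_self.trans (hpa ▸ hp (by omega)), this⟩
  · right
    have hjb : j - wsum 1 a ≤ wsum 1 (c + b) := by omega
    have hle : p' (j - wsum 1 a) ≤ c + b := hpb ▸ hp' hjb
    by_cases hiN : i ≤ N
    · simp only [q, hiN, hjN, if_true, if_false] at hmod
      have hcj : c ≤ p' (j - wsum 1 a) := by
        conv_lhs => rw [← hpc']
        exact hp' (by omega)
      by_cases hic : i ≤ wsum 1 c
      · left
        have hpi : p i ≤ c := by
          conv_rhs => rw [← hpc]
          exact hp hic
        have := exists_zero_sum_of_lt (hpi.trans hcj)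
          (by rw [hps i (by omega), hps' _ hjb]; omega) hmod
        exact ⟨_, tsub_le_self.trans hle, this⟩
      · right
        have hci : c ≤ p i := by
          conv_lhs => rw [← hpc]
          exact hp (by omega)
        have hia : p i ≤ c + a := hpa ▸ hp (by omega)
        have e1 : c + (p i - c) = p i := add_tsub_cancel_of_le hci
        have e2 : c + (p' (j - wsum 1 a) - c) = p' (j - wsum 1 a) := add_tsub_cancel_of_le hcj
        have s1 := wsum_add 1 c (p i - c)
        have s2 := wsum_add 1 c (p' (j - wsum 1 a) - c)
        rw [e1, hps i (by omega)] at s1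
        rw [e2, hps' _ hjb] at s2
        refine ⟨p i - c, tsub_le_iff_left.2 hia, p' (j - wsum 1 a) - c, tsub_le_iff_left.2 hle,
          ?_, ?_, ?_⟩
        · rw [Ne, ← size_eq_zero]; omega
        · rw [Ne, ← size_eq_zero]; omega
        · rw [← e1, ← e2, wsum_add, wsum_add f c] at hmod
          exact Nat.ModEq.add_left_cancel' _ hmod
    · left
      simp only [q, hiN, hjN, if_false] at hmod
      have := exists_zero_sum_of_lt (hp' (show i - wsum 1 a ≤ j - wsum 1 a by omega))
        (by rw [hps' _ (by omega), hps' _ hjb]; omega) hmod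
      exact ⟨_, tsub_le_self.trans hle, this⟩

lemma size_lt_of_zero_sum_free (f : ι → ℕ) {ρ : ℕ} (hρ : 0 < ρ) {v : ι → ℕ}
    (h : ∀ u ≤ v, ρ ∣ wsum f u → u = 0) : wsum 1 v < ρ := by
  by_contra! hv
  rcases exists_zero_sum_branch f hρ v 0 0 (by simpa using hv) with ⟨u, hu, h0, hd⟩ | ⟨u, hu, h0, hd⟩ |
    ⟨a, ha, b, hb, h0, -⟩
  · exact h0 (h u (by simpa using hu) hd)
  · exact h0 (h u (by simpa using hu) hd)
  · exact h0 (le_antisymm ha fun i => Nat.zero_le _)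

end WeightedSums

/-- The data of the tail generators `(w i) n + r i` together with the last one `ω n + ρ`,
which has the largest slope `ρ / ω`, and the bounds `W`, `R`. -/
structure Tail (ι : Type*) where
  r : ι → ℕ
  w : ι → ℕ
  ρ : ℕ
  ω : ℕ
  W : ℕ
  R : ℕ
  ρ_pos : 1 ≤ ρ
  ω_pos : 1 ≤ ω
  r_le : ∀ i, r i ≤ R
  w_le : ∀ i, w i ≤ W
  ρ_le : ρ ≤ R
  ω_le : ω ≤ W
  slope : ∀ i, ω * r i ≤ ρ * w i
  slope_max : ω * R ≤ ρ * W

namespace Tail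

/-- The excess of a generator over the slope of the last generator. -/
def x {ι : Type*} (G : Tail ι) (i : ι) : ℕ := G.ρ * G.w i - G.ω * G.r i

lemma x_le {ι : Type*} (G : Tail ι) (i : ι) : G.x i ≤ G.ρ * G.W :=
  (Nat.sub_le _ _).trans (Nat.mul_le_mul_left _ (G.w_le i))

variable {ι : Type*} [Fintype ι] (G : Tail ι)

lemma excess_add (z : ι → ℕ) :
    wsum G.x z + G.ω * wsum G.r z = G.ρ * wsum G.w z := by
  simp only [wsum, Finset.mul_sum, ← Finset.sum_add_distrib]
  refine Finset.sum_congr rfl fun i _ => ?_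
  have h : G.x i + G.ω * G.r i = G.ρ * G.w i := Nat.sub_add_cancel (G.slope i)
  calc z i * G.x i + G.ω * (z i * G.r i) = z i * (G.x i + G.ω * G.r i) := by ring
    _ = _ := by rw [h]; ring

/-- The semigroup `⟨r₂, …, r_k⟩`. -/
def S : Set ℕ := {s | ∃ (z : ι → ℕ) (t : ℕ), s = wsum G.r z + t * G.ρ}

/-- The minimal weight of a factorization of `s`. -/
noncomputable def M (s : ℕ) : ℕ :=
  sInf {c | ∃ (z : ι → ℕ) (t : ℕ), s = wsum G.r z + t * G.ρ ∧ c = wsum G.w z + t * G.ω}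

/-- The minimal excess among multiplicity vectors in the class of `s` modulo `ρ`. -/
noncomputable def E (s : ℕ) : ℕ :=
  sInf {c | ∃ z : ι → ℕ, wsum G.r z ≡ s [MOD G.ρ] ∧ c = wsum G.x z}

variable {G}

lemma M_of_notMem {s : ℕ} (h : s ∉ G.S) : G.M s = 0 := by
  have : {c | ∃ (z : ι → ℕ) (t : ℕ), s = wsum G.r z + t * G.ρ ∧ c = wsum G.w z + t * G.ω} = ∅ := by
    ext c
    simp only [Set.mem_ofPred_eq, Set.mem_empty_iff_false, iff_false]
    rintro ⟨z, t, h1, -⟩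
    exact h ⟨z, t, h1⟩
  rw [M, this, Nat.sInf_empty]

lemma M_le (z : ι → ℕ) (t : ℕ) :
    G.M (wsum G.r z + t * G.ρ) ≤ wsum G.w z + t * G.ω :=
  Nat.sInf_le ⟨z, t, rfl, rfl⟩

lemma E_le {s : ℕ} {z : ι → ℕ} (h : wsum G.r z ≡ s [MOD G.ρ]) : G.E s ≤ wsum G.x z :=
  Nat.sInf_le ⟨z, h, rfl⟩

lemma exists_M {s : ℕ} (hs : s ∈ G.S) :
    ∃ (z : ι → ℕ) (t : ℕ), s = wsum G.r z + t * G.ρ ∧ G.M s = wsum G.w z + t * G.ω := by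
  obtain ⟨z, t, h⟩ := hs
  exact Nat.sInf_mem (s := {c | ∃ (z : ι → ℕ) (t : ℕ),
    s = wsum G.r z + t * G.ρ ∧ c = wsum G.w z + t * G.ω}) ⟨_, z, t, h, rfl⟩

lemma exists_E {s : ℕ} (hs : ∃ z : ι → ℕ, wsum G.r z ≡ s [MOD G.ρ]) :
    ∃ z : ι → ℕ, wsum G.r z ≡ s [MOD G.ρ] ∧ G.E s = wsum G.x z := by
  obtain ⟨z, h⟩ := hs
  exact Nat.sInf_mem (s := {c | ∃ z : ι → ℕ, wsum G.r z ≡ s [MOD G.ρ] ∧ c = wsum G.x z})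
    ⟨_, z, h, rfl⟩

lemma E_add (s : ℕ) (j : ℕ) : G.E (s + j * G.ρ) = G.E s := by
  have h : s + j * G.ρ ≡ s [MOD G.ρ] := by simp [Nat.ModEq]
  unfold E
  congr 1
  ext c
  exact exists_congr fun z => and_congr_left fun _ =>
    ⟨fun h' => h'.trans h, fun h' => h'.trans h.symm⟩

lemma excess_rep (z : ι → ℕ) (t : ℕ) :
    G.ρ * (wsum G.w z + t * G.ω) = G.ω * (wsum G.r z + t * G.ρ) + wsum G.x z := by
  have := G.excess_add z
  linear_combination -this

lemma rep_modEq (z : ι → ℕ) (t : ℕ) : wsum G.r z ≡ wsum G.r z + t * G.ρ [MOD G.ρ] := by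
  simp [Nat.ModEq]

lemma le_rho_mul_M {s : ℕ} (hs : s ∈ G.S) : G.ω * s + G.E s ≤ G.ρ * G.M s := by
  obtain ⟨z, t, rfl, hM⟩ := exists_M hs
  rw [hM, excess_rep]
  gcongr
  exact E_le (rep_modEq z t)

lemma exists_min {α : Type*} (p : α → Prop) (f : α → ℕ) (h : ∃ a, p a) :
    ∃ a, p a ∧ ∀ b, p b → f a ≤ f b := by
  obtain ⟨a, ha, hmin⟩ := WellFounded.has_min (InvImage.wf f Nat.lt_wfRel.wf) {a | p a} h
  exact ⟨a, ha, fun b hb => not_lt.1 (hmin b hb)⟩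

lemma eq_add_sub_add {a b z : ι → ℕ} (h : a ≤ z) (f : ι → ℕ) :
    wsum f (z - a + b) + wsum f a = wsum f z + wsum f b := by
  have h1 : z - a + a = z := tsub_add_cancel_of_le h
  have h2 := wsum_add f (z - a) a
  rw [h1] at h2
  rw [wsum_add]
  omega

/-- A factorization of minimal weight containing no nontrivial zero-sum part modulo `ρ`. -/
lemma exists_reduced {s : ℕ} (hs : s ∈ G.S) :
    ∃ (z : ι → ℕ) (t : ℕ), s = wsum G.r z + t * G.ρ ∧ G.M s = wsum G.w z + t * G.ω ∧
      ∀ u ≤ z, G.ρ ∣ wsum G.r u → u = 0 := by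
  obtain ⟨z₀, t₀, h₀⟩ := exists_M hs
  obtain ⟨⟨z, t⟩, ⟨hz, hM⟩, hmin⟩ := exists_min
    (fun y : (ι → ℕ) × ℕ => s = wsum G.r y.1 + y.2 * G.ρ ∧ G.M s = wsum G.w y.1 + y.2 * G.ω)
    (fun y => wsum 1 y.1) ⟨(z₀, t₀), h₀⟩
  refine ⟨z, t, hz, hM, fun u hu ⟨e, he⟩ => ?_⟩
  have hr := eq_add_sub_add (b := 0) hu G.r
  have hw := eq_add_sub_add (b := 0) hu G.w
  have h1 := eq_add_sub_add (b := 0) hu 1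
  simp only [add_zero, wsum_zero] at hr hw h1 hz hM
  have hs' : s = wsum G.r (z - u) + (t + e) * G.ρ := by
    rw [add_mul, mul_comm e]; omega
  have hle := M_le (G := G) (z - u) (t + e)
  rw [← hs'] at hle
  have hcost : e * G.ω ≤ wsum G.w u := by
    have := G.excess_add u
    rw [he] at this
    refine Nat.le_of_mul_le_mul_left ?_ G.ρ_pos
    calc G.ρ * (e * G.ω) = G.ω * (G.ρ * e) := by ring
      _ ≤ _ := by omega
  have hM' : G.M s = wsum G.w (z - u) + (t + e) * G.ω := by
    rw [add_mul] at hle ⊢; omega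
  have := hmin (z - u, t + e) ⟨hs', hM'⟩
  simp only at this
  exact size_eq_zero.1 (by omega)

lemma rho_mul_M_le {s : ℕ} (hs : s ∈ G.S) :
    G.ρ * G.M s ≤ G.ω * s + G.ρ * G.W * (G.ρ - 1) := by
  obtain ⟨z, t, rfl, hM, hfree⟩ := exists_reduced hs
  rw [hM, excess_rep]
  have h1 := size_lt_of_zero_sum_free G.r G.ρ_pos hfree
  have h2 := wsum_le_mul_size G.x_le z
  have h3 : G.ρ * G.W * wsum 1 z ≤ G.ρ * G.W * (G.ρ - 1) := Nat.mul_le_mul_left _ (by omega)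
  omega

/-- Replacing a zero-sum part by nothing does not increase the excess. -/
lemma excess_min_class {s : ℕ} {z : ι → ℕ} (hz : wsum G.r z ≡ s [MOD G.ρ]) {a b : ι → ℕ}
    (ha : a ≤ z) (hab : wsum G.r a ≡ wsum G.r b [MOD G.ρ]) :
    wsum G.r (z - a + b) ≡ s [MOD G.ρ] := by
  have h := eq_add_sub_add (b := b) ha G.r
  have h1 : wsum G.r (z - a + b) + wsum G.r a ≡ wsum G.r z + wsum G.r a [MOD G.ρ] := by
    rw [h]; exact Nat.ModEq.add_left _ hab.symm
  exact (Nat.ModEq.add_right_cancel' _ h1).trans hz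

lemma M_of_large {s : ℕ} (hcl : ∃ z : ι → ℕ, wsum G.r z ≡ s [MOD G.ρ])
    (hs : (G.ρ - 1) * G.R ≤ s) : s ∈ G.S ∧ G.ρ * G.M s = G.ω * s + G.E s := by
  obtain ⟨z₀, hz₀, hE₀⟩ := exists_E hcl
  obtain ⟨z, ⟨hz, hE⟩, hmin⟩ := exists_min
    (fun z : ι → ℕ => wsum G.r z ≡ s [MOD G.ρ] ∧ G.E s = wsum G.x z) (wsum 1) ⟨z₀, hz₀, hE₀⟩
  have hfree : ∀ u ≤ z, G.ρ ∣ wsum G.r u → u = 0 := by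
    intro u hu hd
    have hcl' := excess_min_class hz hu (b := 0)
      (by simpa using Nat.modEq_zero_iff_dvd.2 hd)
    have hx := eq_add_sub_add (b := 0) hu G.x
    have h1 := eq_add_sub_add (b := 0) hu 1
    have hle := E_le hcl'
    simp only [wsum_zero, add_zero] at hx h1 hle hcl'
    have := hmin (z - u) ⟨hcl', by omega⟩
    exact size_eq_zero.1 (by omega)
  have h1 := size_lt_of_zero_sum_free G.r G.ρ_pos hfree
  have h2 := wsum_le_mul_size G.r_le z
  have h3 : G.R * wsum 1 z ≤ G.R * (G.ρ - 1) := Nat.mul_le_mul_left _ (by omega)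
  rw [mul_comm] at hs
  obtain ⟨t, ht⟩ := (Nat.modEq_iff_dvd' (show wsum G.r z ≤ s by omega)).1 hz
  have hs' : s = wsum G.r z + t * G.ρ := by rw [mul_comm]; omega
  have hmem : s ∈ G.S := ⟨z, t, hs'⟩
  refine ⟨hmem, le_antisymm ?_ (le_rho_mul_M hmem)⟩
  have h4 := M_le (G := G) z t
  rw [← hs'] at h4
  calc G.ρ * G.M s ≤ _ := Nat.mul_le_mul_left _ h4
    _ = _ := by rw [excess_rep, ← hs', hE]

/-- Elements of large minimal weight have minimal excess in their class modulo `ρ`. -/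
lemma M_of_large_weight {s : ℕ} (hs : s ∈ G.S) (hM : G.W * G.ρ ≤ G.M s) :
    G.ρ * G.M s = G.ω * s + G.E s := by
  obtain ⟨z, t, hz, hMz, hfree⟩ := exists_reduced hs
  have hzcl : wsum G.r z ≡ s [MOD G.ρ] := by rw [hz]; exact rep_modEq z t
  have hρM : G.ρ * G.M s = G.ω * s + wsum G.x z := by rw [hMz, excess_rep, ← hz]
  obtain ⟨y₀, hy₀⟩ := exists_E ⟨z, hzcl⟩
  obtain ⟨y, ⟨hy, hE⟩, hmin⟩ := exists_min
    (fun y : ι → ℕ => wsum G.r y ≡ s [MOD G.ρ] ∧ G.E s = wsum G.x y)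
    (fun y => (wsum 1 z + 1) * wsum 1 (y - z) + wsum 1 y) ⟨y₀, hy₀⟩
  by_contra hne
  have hlt : G.E s < wsum G.x z := lt_of_le_of_ne (E_le hzcl) (fun h => hne (by rw [hρM, h]))
  have hys : s < wsum G.r y := by
    by_contra! hle
    obtain ⟨e, he⟩ := (Nat.modEq_iff_dvd' hle).1 hy
    have hs' : s = wsum G.r y + e * G.ρ := by rw [mul_comm]; omega
    have h4 := M_le (G := G) y e
    rw [← hs'] at h4
    have h5 := Nat.mul_le_mul_left G.ρ h4
    rw [excess_rep, ← hs'] at h5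
    omega
  have hA := size_lt_of_zero_sum_free G.r G.ρ_pos hfree
  set A := wsum 1 z with hAdef
  have htρ : G.R * (G.ρ - A) ≤ t * G.ρ := by
    by_contra! h
    have h1 : wsum G.w z ≤ G.W * A := wsum_le_mul_size G.w_le z
    have h2 : G.ρ * (t * G.ω) < G.ρ * (G.W * (G.ρ - A)) := by
      calc G.ρ * (t * G.ω) = G.ω * (t * G.ρ) := by ring
        _ < G.ω * (G.R * (G.ρ - A)) := Nat.mul_lt_mul_of_pos_left h G.ω_pos
        _ = G.ω * G.R * (G.ρ - A) := by ring
        _ ≤ G.ρ * G.W * (G.ρ - A) := Nat.mul_le_mul_right _ G.slope_max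
        _ = _ := by ring
    have h3 := Nat.lt_of_mul_lt_mul_left h2
    have h4 : G.W * G.ρ = G.W * A + G.W * (G.ρ - A) := by
      rw [← mul_add]; congr 1; omega
    omega
  obtain ⟨c, a, b, hza, hyb, hdisj⟩ : ∃ c a b : ι → ℕ, z = c + a ∧ y = c + b ∧
      ∀ i, a i = 0 ∨ b i = 0 :=
    ⟨z ⊓ y, z - y, y - z, by ext i; simp only [Pi.add_apply, Pi.sub_apply, Pi.inf_apply]; omega,
      by ext i; simp only [Pi.add_apply, Pi.sub_apply, Pi.inf_apply]; omega,
      fun i => by simp only [Pi.sub_apply]; omega⟩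
  have hyz : y - z = b := by
    ext i
    have := hdisj i
    simp only [hyb, hza, Pi.add_apply, Pi.sub_apply]; omega
  have hbsize : G.ρ - A ≤ wsum 1 b := by
    by_contra! h
    have h1 := wsum_add G.r c a
    have h2 := wsum_add G.r c b
    rw [← hza] at h1
    rw [← hyb] at h2
    have h3 : wsum G.r b ≤ G.R * (G.ρ - A) :=
      (wsum_le_mul_size G.r_le b).trans (Nat.mul_le_mul_left _ h.le)
    omega
  obtain ⟨b', hb', hb's⟩ := exists_sub_of_size hbsize
  have hAca := wsum_add 1 c a
  rw [← hza, ← hAdef] at hAca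
  have hxmin : ∀ u v : ι → ℕ, u ≤ y → wsum G.r u ≡ wsum G.r v [MOD G.ρ] →
      wsum G.x v ≤ wsum G.x u →
      (A + 1) * wsum 1 b + wsum 1 y ≤ (A + 1) * wsum 1 (y - u + v - z) + wsum 1 (y - u + v) ∧
      wsum G.x v = wsum G.x u := by
    intro u v hu huv hx
    have hcl' := excess_min_class hy hu huv
    have hle := E_le hcl'
    have hx' := eq_add_sub_add (b := v) hu G.x
    have := hmin _ ⟨hcl', by omega⟩
    rw [hyz] at this
    exact ⟨this, by omega⟩
  rcases exists_zero_sum_branch G.r G.ρ_pos c a b' (by omega) with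
    ⟨u, hu, h0, hd⟩ | ⟨u, hu, h0, hd⟩ | ⟨a₁, ha₁, b₁, hb₁, ha0, hb0, hab⟩
  · exact h0 (hfree u (hza ▸ hu) hd)
  · have huy : u ≤ y := hu.trans (by rw [hyb]; gcongr)
    have h := (hxmin u 0 huy (by simpa using Nat.modEq_zero_iff_dvd.2 hd) (by simp)).1
    have h1 := eq_add_sub_add (b := 0) huy 1
    simp only [add_zero, wsum_zero] at h h1
    have h2 : wsum 1 (y - u - z) ≤ wsum 1 b :=
      wsum_mono _ (by rw [← hyz]; exact tsub_le_tsub_right tsub_le_self z)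
    have h3 := Nat.mul_le_mul_left (A + 1) h2
    exact h0 (size_eq_zero.1 (by omega))
  · have ha₁z : a₁ ≤ z := ha₁.trans (by rw [hza]; exact le_add_self)
    have hb₁y : b₁ ≤ y := (hb₁.trans hb').trans (by rw [hyb]; exact le_add_self)
    have hrb : wsum G.r b₁ ≤ t * G.ρ := by
      refine le_trans ?_ htρ
      refine (wsum_le_mul_size G.r_le b₁).trans (Nat.mul_le_mul_left _ ?_)
      rw [← hb's]
      exact wsum_mono _ hb₁
    have hr := eq_add_sub_add (b := b₁) ha₁z G.r
    have hcl' := excess_min_class hzcl ha₁z hab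
    have hle : wsum G.r (z - a₁ + b₁) ≤ s := by omega
    obtain ⟨e, he⟩ := (Nat.modEq_iff_dvd' hle).1 hcl'
    have hs' : s = wsum G.r (z - a₁ + b₁) + e * G.ρ := by rw [mul_comm]; omega
    have h4 := M_le (G := G) (z - a₁ + b₁) e
    rw [← hs'] at h4
    have h5 := Nat.mul_le_mul_left G.ρ h4
    rw [excess_rep, ← hs'] at h5
    have hx := eq_add_sub_add (b := b₁) ha₁z G.x
    have h := (hxmin b₁ a₁ hb₁y hab.symm (by omega)).1
    have h1 := eq_add_sub_add (b := a₁) hb₁y 1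
    have hnew : y - b₁ + a₁ - z = b - b₁ := by
      ext i
      have := hdisj i
      have hai : a₁ i ≤ a i := ha₁ i
      have hbi : b₁ i ≤ b i := (hb₁.trans hb') i
      simp only [hyb, hza, Pi.add_apply, Pi.sub_apply]
      omega
    have h2 := eq_add_sub_add (b := 0) (hb₁.trans hb') 1
    simp only [add_zero, wsum_zero] at h2
    rw [hnew, ← h2] at h
    have h6 : wsum 1 a₁ ≤ A := wsum_mono _ ha₁z
    have h7 : wsum 1 b₁ ≠ 0 := fun h => hb0 (size_eq_zero.1 h)
    have h8 : A + 1 ≤ (A + 1) * wsum 1 b₁ := Nat.le_mul_of_pos_right _ (by omega)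
    rw [mul_add] at h
    omega

variable (G) in
/-- `d` is the greatest common divisor of the generators of `G.S`. -/
structure IsGcd (d : ℕ) : Prop where
  pos : 0 < d
  dvd_rho : d ∣ G.ρ
  dvd_of_mem : ∀ s ∈ G.S, d ∣ s
  class_nonempty : ∀ s, d ∣ s → ∃ z : ι → ℕ, wsum G.r z ≡ s [MOD G.ρ]

lemma IsGcd.M_of_large {d s : ℕ} (hd : G.IsGcd d) (hs : d ∣ s) (h : (G.ρ - 1) * G.R ≤ s) :
    s ∈ G.S ∧ G.ρ * G.M s = G.ω * s + G.E s :=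
  Tail.M_of_large (hd.class_nonempty s hs) h

lemma IsGcd.M_add {d s : ℕ} (hd : G.IsGcd d) (hs : d ∣ s) (h : (G.ρ - 1) * G.R ≤ s) (j : ℕ) :
    G.M (s + j * G.ρ) = G.M s + G.ω * j := by
  have h1 := (hd.M_of_large hs h).2
  have h2 := (hd.M_of_large (s := s + j * G.ρ)
    (hs.add (hd.dvd_rho.mul_left j)) (by omega)).2
  rw [E_add] at h2
  refine Nat.eq_of_mul_eq_mul_left G.ρ_pos ?_
  linear_combination h2 - h1

lemma zero_mem : 0 ∈ G.S := ⟨0, 0, by simp⟩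

lemma M_zero : G.M 0 = 0 := by simpa using M_le (G := G) 0 0

lemma W_pos : 1 ≤ G.W := G.ω_pos.trans G.ω_le

lemma large_bound : G.ρ + (G.ρ - 1) * G.R ≤ G.W * G.R ^ 2 := by
  obtain ⟨p, hp⟩ : ∃ p, G.ρ = p + 1 := ⟨G.ρ - 1, by have := G.ρ_pos; omega⟩
  have h1 := G.ρ_le
  rw [hp] at h1 ⊢
  calc p + 1 + (p + 1 - 1) * G.R ≤ G.R + p * G.R := by simpa using h1
    _ = (p + 1) * G.R := by ring
    _ ≤ G.R * G.R := Nat.mul_le_mul_right _ h1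
    _ = 1 * G.R ^ 2 := by ring
    _ ≤ _ := Nat.mul_le_mul_right _ W_pos

lemma M_le_M {s s' : ℕ} (hs : s ∈ G.S) (hs' : s' ∈ G.S) (h : s + G.W * G.R ^ 2 ≤ s') :
    G.M s ≤ G.M s' := by
  refine Nat.le_of_mul_le_mul_left ?_ G.ρ_pos
  have h1 := rho_mul_M_le hs
  have h2 := le_rho_mul_M hs'
  have h3 : G.ρ * G.W * (G.ρ - 1) ≤ G.ω * (G.W * G.R ^ 2) := by
    calc G.ρ * G.W * (G.ρ - 1) ≤ G.R * G.W * G.R :=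
          Nat.mul_le_mul (Nat.mul_le_mul_right _ G.ρ_le) ((Nat.sub_le _ _).trans G.ρ_le)
      _ = 1 * (G.W * G.R ^ 2) := by ring
      _ ≤ _ := Nat.mul_le_mul_right _ G.ω_pos
  have h4 := Nat.mul_le_mul_left G.ω h
  rw [mul_add] at h4
  omega

variable (G) in
/-- The semigroup `P_n` in terms of `S` and minimal weights. -/
def Pn (n : ℕ) : Set ℕ := {x | ∃ s ∈ G.S, ∃ a, G.M s ≤ a ∧ x = a * n + s}

open Classical in
variable (G) in
/-- The smallest element of `G.S` congruent to `d * i` modulo `d * K`, for `i < K`. -/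
noncomputable def star (d K i : ℕ) : ℕ := if d * i ∈ G.S then d * i else d * i + d * K

variable (G) in
/-- The element of the Apéry set of `P_n` in the class of `d * i`. -/
noncomputable def apery (d K n i : ℕ) : ℕ := G.M (G.star d K i) * n + G.star d K i

/-- The arithmetic data relating `n` and `d = gcd(r₂, …, r_k)`. -/
structure Split (d n e q K : ℕ) : Prop where
  n_eq : n = e * K
  d_eq : d = e * q
  coprime : Nat.Coprime q K

lemma Split.mul_eq {d n e q K : ℕ} (h : Split d n e q K) : d * K = q * n := by
  rw [h.n_eq, h.d_eq]; ring

section Large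

variable {d n e q K : ℕ} (hd : G.IsGcd d) (hsp : Split d n e q K) (hn : G.W * G.R ^ 2 < n)

include hd hsp hn

lemma n_le_mul : n ≤ d * K := by
  rw [hsp.mul_eq]
  have : q ≠ 0 := by
    rintro rfl
    have := hd.pos
    have := hsp.d_eq
    omega
  exact Nat.le_mul_of_pos_left _ (by omega)

lemma star_mem (i : ℕ) : G.star d K i ∈ G.S := by
  unfold star
  split_ifs with h
  · exact h
  · have h1 := n_le_mul hd hsp hn
    have h2 := G.large_bound
    exact (hd.M_of_large ((dvd_mul_right d i).add (dvd_mul_right d K)) (by omega)).1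

lemma star_modEq (i : ℕ) : G.star d K i ≡ d * i [MOD n] := by
  unfold star
  split_ifs with h
  · rfl
  · simp [hsp.mul_eq, Nat.ModEq]

lemma apery_modEq (i : ℕ) : G.apery d K n i ≡ d * i [MOD n] := by
  refine Nat.ModEq.trans ?_ (star_modEq hd hsp hn i)
  simp [apery, Nat.ModEq]

lemma K_pos : 0 < K := by
  rcases Nat.eq_zero_or_pos K with h | h
  · have := hsp.n_eq
    rw [h] at this
    omega
  · exact h

lemma e_pos : 0 < e := by
  rcases Nat.eq_zero_or_pos e with h | h
  · have := hsp.n_eq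
    rw [h] at this
    omega
  · exact h

lemma modEq_iff {i j : ℕ} : d * i ≡ d * j [MOD n] ↔ i ≡ j [MOD K] := by
  have he := e_pos hd hsp hn
  rw [hsp.n_eq, hsp.d_eq, mul_assoc, mul_assoc]
  constructor
  · intro h
    have h1 := Nat.ModEq.mul_left_cancel' he.ne' h
    exact Nat.ModEq.cancel_left_of_coprime (hsp.coprime.symm) h1
  · intro h
    exact (h.mul_left q).mul_left' e

lemma mem_Pn_iff {i x : ℕ} (hi : i < K) (hx : x ≡ d * i [MOD n]) :
    x ∈ G.Pn n ↔ G.apery d K n i ≤ x := by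
  constructor
  · rintro ⟨s, hs, a, ha, rfl⟩
    obtain ⟨l, rfl⟩ := hd.dvd_of_mem s hs
    have h1 : l ≡ i [MOD K] := by
      refine (modEq_iff hd hsp hn).1 (Nat.ModEq.trans ?_ hx)
      simp [Nat.ModEq]
    have h2 : l % K = i := by rw [h1, Nat.mod_eq_of_lt hi]
    have h3 : d * l = d * i + d * K * (l / K) := by
      rw [mul_assoc, ← mul_add]
      congr 1
      have := Nat.mod_add_div l K
      omega
    have hle : ∀ s' : ℕ, s' ∈ G.S → (s' = d * l ∨ s' + d * K ≤ d * l) →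
        G.M s' * n + s' ≤ a * n + d * l := by
      rintro s' hs' (rfl | h)
      · gcongr
      · have := n_le_mul hd hsp hn
        have h4 : G.M s' ≤ G.M (d * l) := M_le_M hs' hs (by omega)
        gcongr
        · omega
        · omega
    apply hle _ (star_mem hd hsp hn i)
    unfold star
    rcases Nat.eq_zero_or_pos (l / K) with h0 | h0
    · rw [h0, mul_zero, add_zero] at h3
      rw [if_pos (h3 ▸ hs)]
      exact Or.inl h3.symm
    · obtain ⟨j, hj⟩ : ∃ j, l / K = j + 1 := ⟨l / K - 1, by omega⟩
      rw [hj, mul_add, mul_one] at h3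
      split_ifs with h
      · right
        omega
      · rcases Nat.eq_zero_or_pos j with h5 | h5
        · left; rw [h3, h5]; ring
        · right
          have : d * K ≤ d * K * j := Nat.le_mul_of_pos_right _ h5
          omega
  · intro h
    have h1 := (apery_modEq hd hsp hn i).trans hx.symm
    obtain ⟨c, hc⟩ := (Nat.modEq_iff_dvd' h).1 h1
    refine ⟨_, star_mem hd hsp hn i, G.M (G.star d K i) + c, Nat.le_add_right _ _, ?_⟩
    have h2 : x = G.apery d K n i + n * c := by omega
    rw [h2, apery]; ring

lemma exists_class {x : ℕ} (hx : e ∣ x) : ∃ i < K, x ≡ d * i [MOD n] := by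
  obtain ⟨y, rfl⟩ := hx
  have hK := K_pos hd hsp hn
  obtain ⟨c, -, hc⟩ := Nat.exists_mul_mod_eq_of_coprime y hsp.coprime hK.ne'
  refine ⟨c % K, Nat.mod_lt _ hK, ?_⟩
  have h1 : y ≡ q * (c % K) [MOD K] :=
    (Nat.ModEq.symm hc : y ≡ q * c [MOD K]).trans ((Nat.mod_modEq c K).symm.mul_left q)
  have := h1.mul_left' e
  rwa [← hsp.n_eq, ← mul_assoc, ← hsp.d_eq] at this

lemma e_dvd {i x : ℕ} (hx : x ≡ d * i [MOD n]) : e ∣ x := by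
  have h1 : e ∣ n := ⟨K, hsp.n_eq⟩
  refine (hx.dvd_iff h1).2 ?_
  rw [hsp.d_eq, mul_assoc]
  exact dvd_mul_right _ _

lemma ncard_gaps : {x : ℕ | 0 < x ∧ e ∣ x ∧ x ∉ G.Pn n}.ncard =
    ∑ i ∈ range K, G.apery d K n i / n := by
  have hn0 : 0 < n := by omega
  have hset : {x : ℕ | 0 < x ∧ e ∣ x ∧ x ∉ G.Pn n} = ((range K).biUnion fun i =>
      (range (G.apery d K n i / n)).image fun j => G.apery d K n i % n + n * j : Finset ℕ) := by
    ext x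
    simp only [Set.mem_ofPred_eq, Finset.coe_biUnion, Finset.coe_image, Set.mem_iUnion,
      Set.mem_image, Finset.mem_coe, Finset.mem_range, exists_prop]
    constructor
    · rintro ⟨-, hx, hxP⟩
      obtain ⟨i, hi, hxi⟩ := exists_class hd hsp hn hx
      rw [mem_Pn_iff hd hsp hn hi hxi, not_le] at hxP
      have h1 : x % n = G.apery d K n i % n := hxi.trans (apery_modEq hd hsp hn i).symm
      refine ⟨i, hi, x / n, ?_, by rw [← h1, Nat.mod_add_div]⟩
      by_contra! h2
      have h3 := Nat.mul_le_mul_left n h2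
      have h4 := Nat.mod_add_div x n
      have h5 := Nat.mod_add_div (G.apery d K n i) n
      omega
    · rintro ⟨i, hi, j, hj, rfl⟩
      have h1 : G.apery d K n i % n + n * j ≡ d * i [MOD n] := by
        refine Nat.ModEq.trans ?_ (apery_modEq hd hsp hn i)
        simp [Nat.ModEq]
      have h2 : G.apery d K n i % n + n * j ∉ G.Pn n := by
        rw [mem_Pn_iff hd hsp hn hi h1, not_le]
        have h3 : n * j < n * (G.apery d K n i / n) := Nat.mul_lt_mul_of_pos_left hj hn0
        have h5 := Nat.mod_add_div (G.apery d K n i) n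
        omega
      refine ⟨Nat.pos_of_ne_zero fun h0 => h2 ?_, e_dvd hd hsp hn h1, h2⟩
      rw [h0]
      exact ⟨0, zero_mem, 0, by simp [M_zero], by simp⟩
  rw [hset, Set.ncard_coe_finset, Finset.card_biUnion]
  · refine Finset.sum_congr rfl fun i _ => ?_
    rw [Finset.card_image_of_injective, Finset.card_range]
    intro a b hab
    exact Nat.eq_of_mul_eq_mul_left hn0 (Nat.add_left_cancel hab)
  · intro i hi i' hi' hne
    rw [Finset.mem_coe, Finset.mem_range] at hi hi'
    rw [Function.onFun, Finset.disjoint_left]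
    simp only [Finset.mem_image, not_exists, not_and, forall_exists_index, and_imp]
    rintro x j - rfl j' - h
    have h1 : G.apery d K n i' ≡ G.apery d K n i [MOD n] := by
      have := congrArg (· % n) h
      simpa [Nat.ModEq] using this
    have h2 := ((apery_modEq hd hsp hn i).symm.trans h1.symm).trans (apery_modEq hd hsp hn i')
    have h3 := (modEq_iff hd hsp hn).1 h2
    exact hne (by rw [← Nat.mod_eq_of_lt hi, ← Nat.mod_eq_of_lt hi']; exact h3)

lemma rho_lt_n : G.ρ < n := by
  have h1 := G.large_bound
  have h2 : G.ρ ≤ G.W * G.R ^ 2 := by omega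
  omega

lemma one_lt_K : 1 < K := by
  by_contra! h
  have h1 := Nat.le_of_dvd G.ρ_pos hd.dvd_rho
  have h2 := rho_lt_n hd hsp hn
  have h3 := hsp.n_eq
  have h4 := Nat.le_of_dvd hd.pos ⟨q, hsp.d_eq⟩
  have h5 : e * K ≤ e * 1 := Nat.mul_le_mul_left _ h
  omega

lemma n_le_apery {i : ℕ} (h : 0 < G.star d K i) : n ≤ G.apery d K n i := by
  have h1 := le_rho_mul_M (star_mem hd hsp hn i)
  have h2 : G.M (G.star d K i) ≠ 0 := by
    intro h0
    rw [h0] at h1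
    have := Nat.mul_pos G.ω_pos h
    omega
  have := Nat.le_mul_of_pos_left n (Nat.pos_of_ne_zero h2)
  unfold apery
  omega

/-- The Frobenius number is the largest Apéry element minus `n`. -/
lemma frobenius_spec :
    (∃ i < K, sSup {x : ℕ | e ∣ x ∧ x ∉ G.Pn n} + n = G.apery d K n i) ∧
      ∀ i < K, G.apery d K n i ≤ sSup {x : ℕ | e ∣ x ∧ x ∉ G.Pn n} + n := by
  set X : Set ℕ := {x : ℕ | e ∣ x ∧ x ∉ G.Pn n} with hX
  have hlow : ∀ i < K, n ≤ G.apery d K n i → G.apery d K n i - n ∈ X := by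
    intro i hi hle
    have h1 : G.apery d K n i - n ≡ d * i [MOD n] := by
      refine Nat.ModEq.trans ?_ (apery_modEq hd hsp hn i)
      conv_rhs => rw [← Nat.sub_add_cancel hle]
      simp [Nat.ModEq]
    refine ⟨e_dvd hd hsp hn h1, ?_⟩
    rw [mem_Pn_iff hd hsp hn hi h1]
    omega
  have hupp : ∀ x ∈ X, ∃ i < K, x + n ≤ G.apery d K n i := by
    rintro x ⟨hx, hxP⟩
    obtain ⟨i, hi, hxi⟩ := exists_class hd hsp hn hx
    rw [mem_Pn_iff hd hsp hn hi hxi, not_le] at hxP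
    have h1 := hxi.trans (apery_modEq hd hsp hn i).symm
    obtain ⟨c, hc⟩ := (Nat.modEq_iff_dvd' hxP.le).1 h1
    have hc0 : c ≠ 0 := by rintro rfl; omega
    have := Nat.le_mul_of_pos_right n (Nat.pos_of_ne_zero hc0)
    exact ⟨i, hi, by omega⟩
  have hbdd : BddAbove X := by
    refine ⟨∑ i ∈ range K, G.apery d K n i, fun x hx => ?_⟩
    obtain ⟨i, hi, hle⟩ := hupp x hx
    have := Finset.single_le_sum (f := fun i => G.apery d K n i) (fun _ _ => Nat.zero_le _)
      (Finset.mem_range.2 hi)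
    omega
  have hne : X.Nonempty := by
    refine ⟨_, hlow 1 (one_lt_K hd hsp hn) (n_le_apery hd hsp hn ?_)⟩
    have := hd.pos
    unfold star
    split_ifs <;> omega
  have hge : ∀ i < K, G.apery d K n i ≤ sSup X + n := by
    intro i hi
    by_cases h : n ≤ G.apery d K n i
    · have := le_csSup hbdd (hlow i hi h)
      omega
    · omega
  refine ⟨?_, hge⟩
  obtain ⟨i, hi, hle⟩ := hupp _ (Nat.sSup_mem hne hbdd)
  exact ⟨i, hi, le_antisymm hle (hge i hi)⟩

lemma two_mul_sum_div : 2 * ∑ i ∈ range K, d * i / n = (q - 1) * (K - 1) := by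
  have hn0 : 0 < n := by omega
  have hK := K_pos hd hsp hn
  obtain ⟨k, rfl⟩ : ∃ k, K = k + 1 := ⟨K - 1, by omega⟩
  rw [Finset.sum_range_succ', mul_zero, Nat.zero_div, add_zero, two_mul]
  have hrefl := Finset.sum_range_reflect (fun i => d * (i + 1) / n) k
  nth_rewrite 1 [← hrefl]
  rw [← Finset.sum_add_distrib]
  have h : ∀ i ∈ range k, d * (k - 1 - i + 1) / n + d * (i + 1) / n = q - 1 := by
    intro i hi
    rw [Finset.mem_range] at hi
    have h1 : d * (k - 1 - i + 1) + d * (i + 1) = n * q := by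
      rw [← mul_add, mul_comm n q, ← hsp.mul_eq]
      congr 1
      omega
    have h2 : d * (i + 1) % n ≠ 0 := by
      intro h0
      have h3 : d * (i + 1) ≡ d * 0 [MOD n] := by simpa [Nat.ModEq] using h0
      have h4 : (i + 1) % (k + 1) = 0 % (k + 1) := (modEq_iff hd hsp hn).1 h3
      rw [Nat.mod_eq_of_lt (by omega), Nat.zero_mod] at h4
      omega
    have h5 := Nat.mod_add_div (d * (i + 1)) n
    have h6 := Nat.mod_lt (d * (i + 1)) hn0
    obtain ⟨β, hβdef⟩ : ∃ β, β = d * (i + 1) / n := ⟨_, rfl⟩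
    rw [← hβdef] at h5 ⊢
    have hβ : β + 1 ≤ q := by
      by_contra! h7
      have := Nat.mul_le_mul_left n (show q ≤ β by omega)
      omega
    obtain ⟨δ, hδ⟩ := Nat.exists_eq_add_of_le hβ
    rw [hδ] at h1 ⊢
    have h8 : d * (k - 1 - i + 1) = (n - d * (i + 1) % n) + n * δ := by
      have : n * (β + 1 + δ) = n * β + n + n * δ := by ring
      omega
    rw [h8, Nat.add_mul_div_left _ _ hn0, Nat.div_eq_of_lt (by omega)]
    omega
  rw [Finset.sum_congr rfl h]
  simp [mul_comm]

open Classical in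
/-- The genus in terms of minimal weights. -/
lemma sum_apery_div : ∑ i ∈ range K, G.apery d K n i / n =
    ∑ i ∈ range K, G.M (d * i) + ∑ i ∈ range K, d * i / n +
      ∑ i ∈ (range (G.R ^ 2)).filter (fun i => d * i ∉ G.S), (G.M (d * i + q * n) + q) := by
  have hn0 : 0 < n := by omega
  have hset : (range (G.R ^ 2)).filter (fun i => d * i ∉ G.S) =
      (range K).filter (fun i => d * i ∉ G.S) := by
    ext i
    simp only [Finset.mem_filter, Finset.mem_range, and_congr_left_iff]
    intro hi
    have h1 : d * i < (G.ρ - 1) * G.R := by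
      by_contra! h
      exact hi (hd.M_of_large (dvd_mul_right d i) h).1
    have h2 := G.large_bound
    have h3 := n_le_mul hd hsp hn
    have h4 : i ≤ d * i := Nat.le_mul_of_pos_left _ hd.pos
    have h5 : (G.ρ - 1) * G.R ≤ G.R ^ 2 := by
      rw [sq]
      exact Nat.mul_le_mul_right _ ((Nat.sub_le _ _).trans G.ρ_le)
    have h6 : i < K := Nat.lt_of_mul_lt_mul_left (a := d) (by omega)
    exact ⟨fun _ => h6, fun _ => by omega⟩
  rw [hset, Finset.sum_filter, ← Finset.sum_add_distrib, ← Finset.sum_add_distrib]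
  refine Finset.sum_congr rfl fun i _ => ?_
  rw [apery, mul_comm, Nat.mul_add_div hn0, star]
  by_cases h : d * i ∈ G.S
  · simp [h]
  · simp only [h, if_false, not_false_eq_true, if_true, M_of_notMem h, zero_add]
    rw [hsp.mul_eq, Nat.add_mul_div_right _ _ hn0]
    ring

variable (G d) in
/-- Offsets, relative to `q * n - ρ`, of the candidates for the largest Apéry element. -/
def offsets : Set ℕ := {u | d ∣ u ∧ (u < G.ρ ∨ G.ρ ≤ u ∧ u - G.ρ ∉ G.S)}

lemma offset_lt {u : ℕ} (hu : u ∈ G.offsets d) : u < n := by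
  obtain ⟨h1, h2 | ⟨h2, h3⟩⟩ := hu
  · exact h2.trans (rho_lt_n hd hsp hn)
  · have h4 : u - G.ρ < (G.ρ - 1) * G.R := by
      by_contra! h
      exact h3 (hd.M_of_large (Nat.dvd_sub h1 hd.dvd_rho) h).1
    have h5 := G.large_bound
    omega

lemma rho_le : G.ρ ≤ q * n := by
  have := rho_lt_n hd hsp hn
  have := n_le_mul hd hsp hn
  have := hsp.mul_eq
  omega

lemma large_offset (u : ℕ) : (G.ρ - 1) * G.R ≤ q * n - G.ρ + u := by
  have := G.large_bound
  have := n_le_mul hd hsp hn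
  have := hsp.mul_eq
  omega

lemma dvd_offset {u : ℕ} (hu : d ∣ u) : d ∣ q * n - G.ρ + u := by
  refine Dvd.dvd.add (Nat.dvd_sub ?_ hd.dvd_rho) hu
  rw [← hsp.mul_eq]
  exact dvd_mul_right _ _

lemma exists_star_eq {u : ℕ} (hu : u ∈ G.offsets d) :
    ∃ i < K, G.star d K i = q * n - G.ρ + u := by
  have hrho := rho_le hd hsp hn
  have hmul := hsp.mul_eq
  obtain ⟨h1, h2 | ⟨h2, h3⟩⟩ := hu
  · have hmem := (hd.M_of_large (dvd_offset hd hsp hn h1) (large_offset hd hsp hn u)).1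
    obtain ⟨i, hi⟩ := dvd_offset hd hsp hn h1
    refine ⟨i, Nat.lt_of_mul_lt_mul_left (a := d) (by omega), ?_⟩
    rw [star, if_pos (hi ▸ hmem), hi]
  · have h4 : u - G.ρ < (G.ρ - 1) * G.R := by
      by_contra! h
      exact h3 (hd.M_of_large (Nat.dvd_sub h1 hd.dvd_rho) h).1
    have h5 := G.large_bound
    have h6 := n_le_mul hd hsp hn
    obtain ⟨i, hi⟩ := Nat.dvd_sub h1 hd.dvd_rho
    refine ⟨i, Nat.lt_of_mul_lt_mul_left (a := d) (by omega), ?_⟩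
    rw [star, if_neg (hi ▸ h3)]
    omega

/-- The largest Apéry element is attained at one of the offsets. -/
lemma exists_offset_of_max {i : ℕ} (hi : i < K)
    (hmax : ∀ j < K, G.apery d K n j ≤ G.apery d K n i) :
    ∃ u ∈ G.offsets d, G.star d K i = q * n - G.ρ + u := by
  have hrho := rho_le hd hsp hn
  have hmul := hsp.mul_eq
  have hdi : d * i < d * K := Nat.mul_lt_mul_of_pos_left hi hd.pos
  obtain ⟨p, hp⟩ := hd.dvd_rho
  by_cases hS : d * i ∈ G.S
  · have hstar : G.star d K i = d * i := if_pos hS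
    by_cases hbig : q * n - G.ρ ≤ d * i
    · refine ⟨d * i - (q * n - G.ρ), ⟨?_, Or.inl (by omega)⟩, by omega⟩
      exact Nat.dvd_sub (dvd_mul_right _ _) (by simpa using dvd_offset hd hsp hn (dvd_zero d))
    · exfalso
      by_cases hM : G.W * G.ρ ≤ G.M (d * i)
      · have h1 := M_of_large_weight hS hM
        have hmem : d * (i + p) ∈ G.S := by
          obtain ⟨z, t, hz⟩ := hS
          exact ⟨z, t + 1, by rw [mul_add, ← hp, hz]; ring⟩
        have h2 := le_rho_mul_M hmem
        have h3 : d * (i + p) = d * i + 1 * G.ρ := by rw [hp]; ring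
        rw [h3, E_add, mul_add] at h2
        have h4 : G.M (d * i) ≤ G.M (d * (i + p)) := by
          rw [h3]
          exact Nat.le_of_mul_le_mul_left (by omega) G.ρ_pos
        have h5 := hmax (i + p) (Nat.lt_of_mul_lt_mul_left (a := d) (by omega))
        rw [apery, apery, hstar, star, if_pos hmem] at h5
        have h6 := Nat.mul_le_mul_right n h4
        have h7 := G.ρ_pos
        omega
      · have h0 : 0 ∈ G.offsets d := ⟨dvd_zero d, Or.inl G.ρ_pos⟩
        obtain ⟨j, hj, hjs⟩ := exists_star_eq hd hsp hn h0
        have h1 := le_rho_mul_M (star_mem hd hsp hn j)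
        have h2 := hmax j hj
        have h3 := n_le_mul hd hsp hn
        rw [add_zero] at hjs
        rw [apery, apery, hstar, hjs] at h2
        rw [hjs] at h1
        have h4 : G.M (d * i) ≤ G.M (q * n - G.ρ) := by
          have h5 : G.W * G.R ^ 2 + 1 - G.ρ ≤ q * n - G.ρ := by omega
          have h6 : G.W * G.ρ * G.ρ ≤ G.W * G.R ^ 2 := by
            rw [sq, ← mul_assoc]
            exact Nat.mul_le_mul (Nat.mul_le_mul_left _ G.ρ_le) G.ρ_le
          have h7 : G.W * G.ρ * G.ρ + 1 - G.ρ ≤ G.ω * (q * n - G.ρ) :=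
            calc _ ≤ 1 * (q * n - G.ρ) := by omega
              _ ≤ _ := Nat.mul_le_mul_right _ G.ω_pos
          by_contra! h8
          have h9 : G.M (q * n - G.ρ) + 2 ≤ G.W * G.ρ := by omega
          have h10 := Nat.mul_le_mul_left G.ρ h9
          have h11 : G.ρ * (G.W * G.ρ) = G.W * G.ρ * G.ρ := by ring
          have := G.ρ_pos
          rw [mul_add] at h10
          omega
        have h5 := Nat.mul_le_mul_right n h4
        omega
  · have hstar : G.star d K i = d * i + d * K := if_neg hS
    refine ⟨G.ρ + d * i, ⟨hd.dvd_rho.add (dvd_mul_right _ _),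
      Or.inr ⟨Nat.le_add_right _ _, ?_⟩⟩, ?_⟩
    · rwa [Nat.add_sub_cancel_left]
    · omega

lemma frobenius_offset :
    (∃ u ∈ G.offsets d, sSup {x : ℕ | e ∣ x ∧ x ∉ G.Pn n} + n =
      G.M (q * n - G.ρ + u) * n + (q * n - G.ρ + u)) ∧
    ∀ u ∈ G.offsets d, G.M (q * n - G.ρ + u) * n + (q * n - G.ρ + u) ≤
      sSup {x : ℕ | e ∣ x ∧ x ∉ G.Pn n} + n := by
  obtain ⟨⟨i, hi, hF⟩, hmax⟩ := frobenius_spec hd hsp hn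
  constructor
  · obtain ⟨u, hu, hs⟩ := exists_offset_of_max hd hsp hn hi fun j hj => hF ▸ hmax j hj
    exact ⟨u, hu, by rw [hF, apery, hs]⟩
  · intro u hu
    obtain ⟨j, hj, hs⟩ := exists_star_eq hd hsp hn hu
    rw [← hs]
    exact hmax j hj

lemma Split.shift (j : ℕ) : Split d (n + G.ρ * j) e q (K + G.ρ / e * j) := by
  have hed : e ∣ d := ⟨q, hsp.d_eq⟩
  have heρ := hed.trans hd.dvd_rho
  have hqρ : q ∣ G.ρ / e := by
    rw [Nat.dvd_div_iff_mul_dvd heρ, ← hsp.d_eq]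
    exact hd.dvd_rho
  refine ⟨?_, hsp.d_eq, ?_⟩
  · rw [mul_add, ← mul_assoc, Nat.mul_div_cancel' heρ, hsp.n_eq]
  · obtain ⟨c, hc⟩ := hqρ.mul_right j
    rw [hc]
    simpa using hsp.coprime

lemma M_shift {u : ℕ} (hu : d ∣ u) (j : ℕ) :
    G.M (q * (n + G.ρ * j) - G.ρ + u) = G.M (q * n - G.ρ + u) + G.ω * (q * j) := by
  rw [← hd.M_add (dvd_offset hd hsp hn hu) (large_offset hd hsp hn u)]
  congr 1
  have h1 := rho_le hd hsp hn
  have h2 : q * (n + G.ρ * j) = q * n + q * j * G.ρ := by ring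
  omega

/-- Along a residue class modulo `ρ`, the Frobenius number is quadratic. -/
lemma frobenius_shift : ∃ u μ : ℕ, ∀ j : ℕ,
    sSup {x : ℕ | e ∣ x ∧ x ∉ G.Pn (n + G.ρ * j)} + (n + G.ρ * j) + G.ρ =
      (μ + G.ω * (q * j)) * (n + G.ρ * j) + q * (n + G.ρ * j) + u := by
  obtain ⟨⟨u, hu, hF⟩, hmax⟩ := frobenius_offset hd hsp hn
  refine ⟨u, G.M (q * n - G.ρ + u), fun j => ?_⟩
  have hn' : G.W * G.R ^ 2 < n + G.ρ * j := by omega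
  have hsp' := Split.shift hd hsp hn j
  obtain ⟨⟨v, hv, hF'⟩, hmax'⟩ := frobenius_offset hd hsp' hn'
  have h1 := hmax' u hu
  have h2 := hmax v hv
  have h3 := offset_lt hd hsp hn hu
  have h4 := offset_lt hd hsp hn hv
  have hr := rho_le hd hsp hn
  have hr' := rho_le hd hsp' hn'
  rw [hF] at h2
  rw [hF', M_shift hd hsp hn hu.1, M_shift hd hsp hn hv.1] at h1
  rw [M_shift hd hsp hn hv.1] at hF'
  have hMle : G.M (q * n - G.ρ + v) ≤ G.M (q * n - G.ρ + u) := by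
    by_contra! h
    have := Nat.mul_le_mul_right n (Nat.succ_le_of_lt h)
    rw [Nat.succ_mul] at this
    omega
  have key : (G.M (q * n - G.ρ + v) + G.ω * (q * j)) * (n + G.ρ * j) + v =
      (G.M (q * n - G.ρ + u) + G.ω * (q * j)) * (n + G.ρ * j) + u := by
    refine le_antisymm ?_ (by omega)
    rcases hMle.eq_or_lt with h | h
    · rw [h] at h2 ⊢
      omega
    · have := Nat.mul_le_mul_right (n + G.ρ * j)
        (show G.M (q * n - G.ρ + v) + G.ω * (q * j) + 1 ≤
          G.M (q * n - G.ρ + u) + G.ω * (q * j) by omega)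
      rw [Nat.succ_mul] at this
      omega
  omega

end Large

lemma sum_range_of_add_period (f : ℕ → ℕ) {p c K : ℕ} (hf : ∀ i, K ≤ i → f (i + p) = f i + c)
    (J : ℕ) : ((∑ i ∈ range (K + p * J), f i : ℕ) : ℚ) =
      (∑ i ∈ range K, f i : ℕ) + J * (∑ i ∈ range p, f (K + i) : ℕ) +
        c * p * (J * (J - 1) / 2) := by
  have hJ : ∀ J i : ℕ, f (K + p * J + i) = f (K + i) + c * J := by
    intro J
    induction J with
    | zero => simp
    | succ J ih =>
      intro i
      have h := hf (K + p * J + i) (by omega)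
      rw [ih] at h
      rw [show K + p * (J + 1) + i = K + p * J + i + p by ring, h]
      ring
  induction J with
  | zero => simp
  | succ J ih =>
    rw [show K + p * (J + 1) = K + p * J + p by ring, Finset.sum_range_add, Nat.cast_add, ih,
      Finset.sum_congr rfl fun i _ => hJ J i, Finset.sum_add_distrib]
    simp only [Finset.sum_const, Finset.card_range, smul_eq_mul]
    push_cast
    ring

section LargeShift

variable {d n e q K : ℕ} (hd : G.IsGcd d) (hsp : Split d n e q K) (hn : G.W * G.R ^ 2 < n)

include hd hsp hn

lemma q_pos : 0 < q := by
  rcases Nat.eq_zero_or_pos q with h | h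
  · have h1 := hsp.d_eq
    have := hd.pos
    rw [h] at h1
    omega
  · exact h

/-- Along a residue class modulo `ρ`, the genus is quadratic. -/
lemma genus_shift : ∃ A B C : ℚ, ∀ j : ℕ,
    ({x : ℕ | 0 < x ∧ e ∣ x ∧ x ∉ G.Pn (n + G.ρ * j)}.ncard : ℚ) = A + B * j + C * j ^ 2 := by
  classical
  obtain ⟨p, hp⟩ := hd.dvd_rho
  have he := e_pos hd hsp hn
  have hq := q_pos hd hsp hn
  have hρe : G.ρ / e = p * q := by
    rw [hp, hsp.d_eq, show e * q * p = e * (p * q) by ring, Nat.mul_div_cancel_left _ he]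
  have hnK := n_le_mul hd hsp hn
  have hlarge := G.large_bound
  have hM : ∀ i, K ≤ i → G.M (d * (i + p)) = G.M (d * i) + G.ω := by
    intro i hi
    have h1 := Nat.mul_le_mul_left d hi
    have h2 := hd.M_add (dvd_mul_right d i) (by omega) 1
    rw [one_mul, mul_one] at h2
    rw [mul_add, ← hp, h2]
  set T := (range (G.R ^ 2)).filter (fun i => d * i ∉ G.S)
  refine ⟨(∑ i ∈ range K, G.M (d * i) : ℕ) + (q - 1) * (K - 1) / 2 +
      (∑ i ∈ T, (G.M (d * i + q * n) + q) : ℕ),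
    q * (∑ i ∈ range p, G.M (d * (K + i)) : ℕ) - G.ω * p * q / 2 + (q - 1) * (p * q) / 2 +
      T.card * (G.ω * q), G.ω * p * q ^ 2 / 2, fun j => ?_⟩
  have hn' : G.W * G.R ^ 2 < n + G.ρ * j := by omega
  have hsp' := Split.shift hd hsp hn j
  have hMT : ∀ i, G.M (d * i + q * (n + G.ρ * j)) + q = G.M (d * i + q * n) + q + G.ω * q * j := by
    intro i
    have h2 : d * i + q * (n + G.ρ * j) = d * i + q * n + q * j * G.ρ := by ring
    have h3 := hsp.mul_eq
    rw [h2, hd.M_add ((dvd_mul_right d i).add (h3 ▸ dvd_mul_right d K)) (by omega)]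
    ring
  have hdiv := two_mul_sum_div hd hsp' hn'
  have hK' := K_pos hd hsp' hn'
  rw [ncard_gaps hd hsp' hn', sum_apery_div hd hsp' hn']
  rw [hρe, mul_assoc] at hdiv hK' ⊢
  generalize ∑ i ∈ range (K + p * (q * j)), d * i / (n + G.ρ * j) = D at hdiv ⊢
  zify [hK', hq] at hdiv
  have hdiv' := congrArg (Int.cast : ℤ → ℚ) hdiv
  have hsum := sum_range_of_add_period (fun i => G.M (d * i)) hM (q * j)
  rw [Finset.sum_congr rfl fun i _ => hMT i, Finset.sum_add_distrib, Finset.sum_const,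
    smul_eq_mul, Nat.cast_add, Nat.cast_add, hsum]
  push_cast at hdiv' ⊢
  linear_combination hdiv' / 2

/-- Along a residue class modulo `ρ`, the Frobenius number is a quadratic polynomial. -/
lemma frobenius_quadratic : ∃ A B C : ℚ, ∀ j : ℕ,
    ((sSup {x : ℕ | e ∣ x ∧ x ∉ G.Pn (n + G.ρ * j)} : ℕ) : ℚ) = A + B * j + C * j ^ 2 := by
  obtain ⟨u, μ, h⟩ := frobenius_shift hd hsp hn
  refine ⟨μ * n + q * n + u - n - G.ρ, G.ω * q * n + μ * G.ρ + q * G.ρ - G.ρ,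
    G.ω * q * G.ρ, fun j => ?_⟩
  have h1 := congrArg (Nat.cast : ℕ → ℚ) (h j)
  push_cast at h1
  linear_combination h1

end LargeShift

lemma isGcd_gcd : G.IsGcd (Nat.gcd G.ρ (univ.gcd G.r)) where
  pos := Nat.gcd_pos_of_pos_left _ G.ρ_pos
  dvd_rho := Nat.gcd_dvd_left _ _
  dvd_of_mem := by
    rintro s ⟨z, t, rfl⟩
    refine Dvd.dvd.add ((Nat.gcd_dvd_right _ _).trans ?_) ((Nat.gcd_dvd_left _ _).mul_left t)
    exact Finset.dvd_sum fun i _ => (Finset.gcd_dvd (Finset.mem_univ i)).mul_left _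
  class_nonempty := by
    rintro s ⟨c, rfl⟩
    have : NeZero G.ρ := ⟨by have := G.ρ_pos; omega⟩
    obtain ⟨y, hy⟩ := exists_sum_mul_eq_gcd univ G.r
    have hb := Nat.gcd_eq_gcd_ab G.ρ (univ.gcd G.r)
    set b := Nat.gcdB G.ρ (univ.gcd G.r)
    refine ⟨fun i => ((c * b * y i : ℤ) : ZMod G.ρ).val, ?_⟩
    rw [← ZMod.natCast_eq_natCast_iff, wsum]
    have hb' := congrArg (Int.cast : ℤ → ZMod G.ρ) hb
    rw [← hy] at hb'
    push_cast at hb' ⊢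
    rw [hb']
    simp only [ZMod.natCast_val, ZMod.cast_id, ZMod.natCast_self, zero_mul, zero_add,
      Finset.sum_mul]
    refine Finset.sum_congr rfl fun i _ => ?_
    ring

section Positivity

variable {d n e q K : ℕ} (hd : G.IsGcd d) (hsp : Split d n e q K) (hn : G.W * G.R ^ 2 < n)

include hd hsp hn

lemma le_frobenius : (G.ω * (q * n - d) * n : ℚ) ≤
    G.ρ * ((sSup {x : ℕ | e ∣ x ∧ x ∉ G.Pn n} : ℕ) + n) := by
  have hK := K_pos hd hsp hn
  have h1 := (frobenius_spec hd hsp hn).2 (K - 1) (by omega)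
  have h2 := le_rho_mul_M (star_mem hd hsp hn (K - 1))
  have h3 : d * (K - 1) ≤ G.star d K (K - 1) := by
    unfold star
    split_ifs <;> omega
  rw [apery] at h1
  have h4 : G.ω * (d * (K - 1)) * n ≤ G.ρ * (sSup {x : ℕ | e ∣ x ∧ x ∉ G.Pn n} + n) :=
    calc G.ω * (d * (K - 1)) * n ≤ G.ω * G.star d K (K - 1) * n := by gcongr
      _ ≤ G.ρ * G.M (G.star d K (K - 1)) * n := Nat.mul_le_mul_right _ (by omega)
      _ = G.ρ * (G.M (G.star d K (K - 1)) * n) := by ring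
      _ ≤ _ := Nat.mul_le_mul_left _ (by omega)
  have h5 : ((d * (K - 1) : ℕ) : ℚ) = q * n - d := by
    have h := congrArg (Nat.cast : ℕ → ℚ) hsp.mul_eq
    push_cast [Nat.cast_sub (show 1 ≤ K from hK)] at h ⊢
    linear_combination h
  have h6 : ((G.ω * (d * (K - 1)) * n : ℕ) : ℚ) ≤
    ((G.ρ * (sSup {x : ℕ | e ∣ x ∧ x ∉ G.Pn n} + n) : ℕ) : ℚ) := by exact_mod_cast h4
  rw [Nat.cast_mul, Nat.cast_mul, h5] at h6
  push_cast at h6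
  exact h6

variable (G d) in
/-- The coefficient of the linear term in an upper bound for twice `ρ` times the genus. -/
def genusBound : ℕ := 2 * (G.ρ * G.W * G.ρ) + G.ρ * d +
  2 * (G.R ^ 2 * (G.ω * (d * G.R ^ 2 + d) + G.ρ * G.W * G.ρ + G.ρ * d))

lemma genus_le : 2 * G.ρ * {x : ℕ | 0 < x ∧ e ∣ x ∧ x ∉ G.Pn n}.ncard ≤
    G.ω * q * n ^ 2 + G.genusBound d * n := by
  classical
  have hK := K_pos hd hsp hn
  have he := e_pos hd hsp hn
  have hKn : K ≤ n := by
    rw [hsp.n_eq]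
    exact Nat.le_mul_of_pos_left _ he
  have hqd : q ≤ d := by
    rw [hsp.d_eq]
    exact Nat.le_mul_of_pos_left _ he
  have hn0 : 1 ≤ n := by omega
  have hM : ∀ s, G.ρ * G.M s ≤ G.ω * s + G.ρ * G.W * G.ρ := by
    intro s
    by_cases hs : s ∈ G.S
    · refine (rho_mul_M_le hs).trans ?_
      gcongr
      omega
    · simp [M_of_notMem hs]
  have h1 : 2 * (G.ρ * ∑ i ∈ range K, G.M (d * i)) ≤
      G.ω * q * n ^ 2 + 2 * (G.ρ * G.W * G.ρ) * n := by
    calc _ ≤ 2 * ∑ i ∈ range K, (G.ω * (d * i) + G.ρ * G.W * G.ρ) := by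
          rw [Finset.mul_sum]
          gcongr with i
          exact hM _
      _ = G.ω * d * ((∑ i ∈ range K, i) * 2) + 2 * (G.ρ * G.W * G.ρ) * K := by
          have h : ∑ i ∈ range K, G.ω * (d * i) = G.ω * d * ∑ i ∈ range K, i := by
            rw [Finset.mul_sum]
            exact Finset.sum_congr rfl fun i _ => by ring
          rw [Finset.sum_add_distrib, h, Finset.sum_const, Finset.card_range, smul_eq_mul]
          ring
      _ ≤ G.ω * d * (K * K) + 2 * (G.ρ * G.W * G.ρ) * n := by
          rw [Finset.sum_range_id_mul_two]
          gcongr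
          omega
      _ = G.ω * (d * K) * K + 2 * (G.ρ * G.W * G.ρ) * n := by ring
      _ ≤ G.ω * (q * n) * n + 2 * (G.ρ * G.W * G.ρ) * n := by
          rw [hsp.mul_eq]
          gcongr
      _ = _ := by ring
  have h2 : G.ρ * (2 * ∑ i ∈ range K, d * i / n) ≤ G.ρ * d * n := by
    rw [two_mul_sum_div hd hsp hn, mul_assoc]
    gcongr <;> omega
  have h3 : G.ρ * ∑ i ∈ (range (G.R ^ 2)).filter (fun i => d * i ∉ G.S),
      (G.M (d * i + q * n) + q) ≤
      G.R ^ 2 * (G.ω * (d * G.R ^ 2 + d) + G.ρ * G.W * G.ρ + G.ρ * d) * n := by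
    rw [Finset.mul_sum, mul_assoc]
    refine (Finset.sum_le_card_nsmul _ _
      ((G.ω * (d * G.R ^ 2 + d) + G.ρ * G.W * G.ρ + G.ρ * d) * n) fun i hi => ?_).trans ?_
    · have hi' := (Finset.mem_range.1 (Finset.mem_filter.1 hi).1).le
      calc G.ρ * (G.M (d * i + q * n) + q)
          = G.ρ * G.M (d * i + q * n) + G.ρ * q := by ring
        _ ≤ G.ω * (d * i + q * n) + G.ρ * G.W * G.ρ + G.ρ * q := by
          gcongr
          exact hM _
        _ ≤ G.ω * (d * G.R ^ 2 * n + d * n) + G.ρ * G.W * G.ρ * n + G.ρ * d * n := by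
          have := Nat.le_mul_of_pos_right (d * G.R ^ 2) hn0
          have h4 : d * i ≤ d * G.R ^ 2 := Nat.mul_le_mul_left _ hi'
          have h5 := Nat.le_mul_of_pos_right (G.ρ * d) hn0
          have h6 : G.ρ * q ≤ G.ρ * d := Nat.mul_le_mul_left _ hqd
          have h7 := Nat.le_mul_of_pos_right (G.ρ * G.W * G.ρ) hn0
          have h8 := Nat.mul_le_mul_right n hqd
          have h9 : G.ω * (d * i + q * n) ≤ G.ω * (d * G.R ^ 2 * n + d * n) :=
            Nat.mul_le_mul_left _ (by omega)
          omega
        _ = _ := by ring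
    · rw [smul_eq_mul]
      gcongr
      exact (Finset.card_filter_le _ _).trans (Finset.card_range _).le
  rw [ncard_gaps hd hsp hn, sum_apery_div hd hsp hn, genusBound]
  linarith

lemma wilf_pos {m : ℕ} (hm : 1 ≤ m) (hlarge : (m + 1) * (2 * (G.ω * d) + 2 * G.ρ) +
      (m + 2) * G.genusBound d + 2 * G.ρ < n) :
    (0 : ℚ) < (m + 2) * ((sSup {x : ℕ | e ∣ x ∧ x ∉ G.Pn n} : ℕ) -
      {x : ℕ | 0 < x ∧ e ∣ x ∧ x ∉ G.Pn n}.ncard) -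
        ((sSup {x : ℕ | e ∣ x ∧ x ∉ G.Pn n} : ℕ) + 1) := by
  have hF := le_frobenius hd hsp hn
  have hg : (2 * G.ρ * {x : ℕ | 0 < x ∧ e ∣ x ∧ x ∉ G.Pn n}.ncard : ℚ) ≤
    G.ω * q * n ^ 2 + G.genusBound d * n := by exact_mod_cast genus_le hd hsp hn
  have hq : (1 : ℚ) ≤ G.ω * q := by
    exact_mod_cast Nat.mul_pos G.ω_pos (q_pos hd hsp hn)
  generalize sSup {x : ℕ | e ∣ x ∧ x ∉ G.Pn n} = F at hF ⊢
  generalize {x : ℕ | 0 < x ∧ e ∣ x ∧ x ∉ G.Pn n}.ncard = g at hg ⊢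
  have hρ : (1 : ℚ) ≤ G.ρ := by exact_mod_cast G.ρ_pos
  have hm' : (1 : ℚ) ≤ m := by exact_mod_cast hm
  have hn1 : (1 : ℚ) ≤ n := by exact_mod_cast (show 1 ≤ n by omega)
  have hlarge' : (((m + 1) * (2 * (G.ω * d) + 2 * G.ρ) +
      (m + 2) * G.genusBound d : ℕ) : ℚ) + 2 * G.ρ + 1 ≤ n := by exact_mod_cast hlarge
  push_cast at hlarge'
  have h1 : (n : ℚ) ^ 2 ≤ m * (G.ω * q) * n ^ 2 := by
    have : (1 : ℚ) ≤ m * (G.ω * q) := by nlinarith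
    exact le_mul_of_one_le_left (by positivity) this
  have h2 := mul_le_mul_of_nonneg_right hlarge' (show (0 : ℚ) ≤ n by positivity)
  have h3 : (G.ρ : ℚ) ≤ G.ρ * n := le_mul_of_one_le_right (by positivity) hn1
  have h4 := mul_le_mul_of_nonneg_left hF (show (0 : ℚ) ≤ 2 * (m + 1) by positivity)
  have h5 := mul_le_mul_of_nonneg_left hg (show (0 : ℚ) ≤ m + 2 by positivity)
  have key : (0 : ℚ) < 2 * G.ρ * ((m + 2) * (F - g) - (F + 1)) := by
    nlinarith
  exact pos_of_mul_pos_right key (by positivity)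

end Positivity

lemma Split.of_gcd {d : ℕ} (hd : 0 < d) (n : ℕ) :
    Split d n (Nat.gcd n d) (d / Nat.gcd n d) (n / Nat.gcd n d) where
  n_eq := (Nat.mul_div_cancel' (Nat.gcd_dvd_left n d)).symm
  d_eq := (Nat.mul_div_cancel' (Nat.gcd_dvd_right n d)).symm
  coprime := (Nat.coprime_div_gcd_div_gcd (Nat.gcd_pos_of_pos_right n hd)).symm

lemma Split.gcd_eq {d n e q K : ℕ} (h : Split d n e q K) : Nat.gcd n d = e := by
  rw [h.n_eq, h.d_eq, Nat.gcd_mul_left, h.coprime.symm.gcd_eq_one, mul_one]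

/-- The tail determined by generators sorted by slope. -/
def ofSorted {m : ℕ} {w r : Fin (m + 1) → ℕ} (hw : ∀ i, 1 ≤ w i) (hrk : 1 ≤ r (Fin.last m))
    (hsort : ∀ i j : Fin (m + 1), i ≤ j → (r i : ℚ) / (w i : ℚ) ≤ (r j : ℚ) / (w j : ℚ)) :
    Tail (Fin m) :=
  have hslope : ∀ i, w (Fin.last m) * r i ≤ r (Fin.last m) * w i := fun i => by
    have hpos : ∀ i, (0 : ℚ) < w i := fun i => by exact_mod_cast hw i
    have h := (div_le_div_iff₀ (hpos _) (hpos _)).1 (hsort i (Fin.last m) (Fin.le_last i))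
    rw [mul_comm]
    exact_mod_cast h
  { r := fun i => r i.castSucc
    w := fun i => w i.castSucc
    ρ := r (Fin.last m)
    ω := w (Fin.last m)
    W := max 1 (univ.sup w)
    R := univ.sup r
    ρ_pos := hrk
    ω_pos := hw _
    r_le := fun i => Finset.le_sup (f := r) (Finset.mem_univ _)
    w_le := fun i => (Finset.le_sup (f := w) (Finset.mem_univ _)).trans (le_max_right _ _)
    ρ_le := Finset.le_sup (f := r) (Finset.mem_univ _)
    ω_le := (Finset.le_sup (f := w) (Finset.mem_univ _)).trans (le_max_right _ _)
    slope := fun i => hslope _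
    slope_max := by
      obtain ⟨i, -, hi⟩ := Finset.exists_mem_eq_sup univ Finset.univ_nonempty r
      rw [hi]
      exact (hslope i).trans (Nat.mul_le_mul_left _
        ((Finset.le_sup (f := w) (Finset.mem_univ i)).trans (le_max_right _ _))) }

section OfSorted

variable {m : ℕ} {w r : Fin (m + 1) → ℕ} (hw : ∀ i, 1 ≤ w i) (hrk : 1 ≤ r (Fin.last m))
  (hsort : ∀ i j : Fin (m + 1), i ≤ j → (r i : ℚ) / (w i : ℚ) ≤ (r j : ℚ) / (w j : ℚ))

lemma ofSorted_Pn (N : ℕ) : (ofSorted hw hrk hsort).Pn N =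
    {x | ∃ z₀ : ℕ, ∃ z : Fin (m + 1) → ℕ, x = z₀ * N + ∑ i, z i * (w i * N + r i)} := by
  have key : ∀ z : Fin (m + 1) → ℕ, ∑ i, z i * (w i * N + r i) =
      (wsum (ofSorted hw hrk hsort).w (fun i => z i.castSucc) + z (Fin.last m) * w (Fin.last m)) * N
      + (wsum (ofSorted hw hrk hsort).r (fun i => z i.castSucc) +
        z (Fin.last m) * r (Fin.last m)) := by
    intro z
    have h : ∀ f : Fin (m + 1) → ℕ,
        wsum (fun i : Fin m => f i.castSucc) (fun i => z i.castSucc) +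
          z (Fin.last m) * f (Fin.last m) = ∑ i, z i * f i := fun f => by
      rw [Fin.sum_univ_castSucc, wsum]
    refine Eq.trans ?_ (congrArg₂ (fun a b => a * N + b) (h w) (h r)).symm
    rw [Finset.sum_mul, ← Finset.sum_add_distrib]
    exact Finset.sum_congr rfl fun i _ => by ring
  ext x
  constructor
  · rintro ⟨s, hs, a, ha, rfl⟩
    obtain ⟨z, t, rfl, hM⟩ := exists_M hs
    rw [hM] at ha
    obtain ⟨c, rfl⟩ := Nat.exists_eq_add_of_le ha
    refine ⟨c, Fin.snoc (α := fun _ => ℕ) z t, ?_⟩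
    rw [key]
    simp only [Fin.snoc_castSucc, Fin.snoc_last]
    change (_ + t * w (Fin.last m) + c) * N + (_ + t * r (Fin.last m)) = _
    ring
  · rintro ⟨z₀, z, rfl⟩
    refine ⟨_, ⟨fun i => z i.castSucc, z (Fin.last m), rfl⟩, _,
      (M_le _ _).trans (Nat.le_add_left _ z₀), ?_⟩
    rw [key]
    change _ = (z₀ + (_ + z (Fin.last m) * w (Fin.last m))) * N +
      (_ + z (Fin.last m) * r (Fin.last m))
    ring

lemma ofSorted_gcd (N : ℕ) : Nat.gcd N (univ.gcd fun i => w i * N + r i) =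
    Nat.gcd N (Nat.gcd (ofSorted hw hrk hsort).ρ (univ.gcd (ofSorted hw hrk hsort).r)) := by
  refine Nat.dvd_left_iff_eq.1 fun c => ?_
  simp only [Nat.dvd_gcd_iff, Finset.dvd_gcd_iff, Finset.mem_univ, true_imp_iff]
  refine and_congr_right fun hc => ?_
  simp only [Nat.dvd_add_right (hc.mul_left _)]
  rw [Fin.forall_fin_succ', and_comm]
  rfl

end OfSorted

end Tail

/-- Corollary (Wilf numbers of `P_n = ⟨n, w₂n+r₂,…,w_kn+r_k⟩`): the Wilf number
`𝖶(P_n) = k(F(P_n) − g(P_n)) − (F(P_n)+1)` is `r_k`-quasiquadratic for `n > W·R²`,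
and if `k ≥ 3` then `𝖶(P_n) > 0` for all sufficiently large `n`.
The tail generators are indexed by `Fin (m+1)`, so the total number of generators is
`k = m + 2`, and `k ≥ 3` corresponds to `1 ≤ m`. -/
theorem stmt_17 (m : ℕ) (w r : Fin (m+1) → ℕ) (hw : ∀ i, 1 ≤ w i)
    (hrk : 1 ≤ r (Fin.last m))
    (hsort : ∀ i j : Fin (m+1), i ≤ j → (r i : ℚ) / (w i : ℚ) ≤ (r j : ℚ) / (w j : ℚ))
    (P : ℕ → Set ℕ)
    (hP : ∀ N : ℕ, P N = {x | ∃ z₀ : ℕ, ∃ z : Fin (m+1) → ℕ,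
      x = z₀ * N + ∑ i, z i * (w i * N + r i)})
    (W : ℕ) (hW : W = max 1 (Finset.univ.sup w))
    (R : ℕ) (hR : R = Finset.univ.sup r)
    (dP : ℕ → ℕ) (hdP : ∀ N, dP N = Nat.gcd N (Finset.univ.gcd fun i => w i * N + r i))
    (F : ℕ → ℕ) (hF : ∀ N, F N = sSup {x : ℕ | dP N ∣ x ∧ x ∉ P N})
    (g : ℕ → ℕ) (hg : ∀ N, g N = {x : ℕ | 0 < x ∧ dP N ∣ x ∧ x ∉ P N}.ncard)
    (Wilf : ℕ → ℚ)
    (hWilf : ∀ N, Wilf N = ((m : ℚ) + 2) * ((F N : ℚ) - (g N : ℚ)) - ((F N : ℚ) + 1)) :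
    (∃ c₂ c₁ c₀ : ℤ → ℚ,
      (∀ t : ℤ, c₂ (t + (r (Fin.last m) : ℤ)) = c₂ t) ∧
      (∀ t : ℤ, c₁ (t + (r (Fin.last m) : ℤ)) = c₁ t) ∧
      (∀ t : ℤ, c₀ (t + (r (Fin.last m) : ℤ)) = c₀ t) ∧
      ∀ n : ℕ, W * R ^ 2 < n →
        Wilf n = c₂ (n : ℤ) * (n : ℚ) ^ 2 + c₁ (n : ℤ) * (n : ℚ) + c₀ (n : ℤ)) ∧
    (1 ≤ m → ∃ N : ℕ, ∀ n : ℕ, N < n → 0 < Wilf n) := by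
  set G := Tail.ofSorted hw hrk hsort
  set d := Nat.gcd G.ρ (univ.gcd G.r)
  have hd : G.IsGcd d := Tail.isGcd_gcd
  have hGW : G.W = W := hW.symm
  have hGR : G.R = R := hR.symm
  have hPn : ∀ N, P N = G.Pn N := fun N => by rw [hP, Tail.ofSorted_Pn hw hrk hsort]
  have hdPn : ∀ N, dP N = Nat.gcd N d := fun N => by rw [hdP, Tail.ofSorted_gcd hw hrk hsort]
  simp only [hdPn, hPn] at hF hg
  constructor
  · refine exists_quasiquadratic hrk fun n hn => ?_
    have hn' : G.W * G.R ^ 2 < n := by rwa [hGW, hGR]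
    have hsp := Tail.Split.of_gcd hd.pos n
    obtain ⟨A, B, C, hFq⟩ := Tail.frobenius_quadratic hd hsp hn'
    obtain ⟨A', B', C', hgq⟩ := Tail.genus_shift hd hsp hn'
    refine ⟨(m + 2) * (A - A') - (A + 1), (m + 2) * (B - B') - B, (m + 2) * (C - C') - C,
      fun j => ?_⟩
    have he := (Tail.Split.shift hd hsp hn' j).gcd_eq
    rw [hWilf, hF, hg]
    change (m + 2 : ℚ) * (((sSup {x : ℕ | Nat.gcd (n + G.ρ * j) d ∣ x ∧
      x ∉ G.Pn (n + G.ρ * j)} : ℕ) : ℚ) - ({x : ℕ | 0 < x ∧ Nat.gcd (n + G.ρ * j) d ∣ x ∧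
      x ∉ G.Pn (n + G.ρ * j)}.ncard : ℚ)) - (((sSup {x : ℕ | Nat.gcd (n + G.ρ * j) d ∣ x ∧
      x ∉ G.Pn (n + G.ρ * j)} : ℕ) : ℚ) + 1) = _
    rw [he, hFq, hgq]
    ring
  · intro hm
    refine ⟨max (G.W * G.R ^ 2) ((m + 1) * (2 * (G.ω * d) + 2 * G.ρ) +
      (m + 2) * G.genusBound d + 2 * G.ρ), fun n hn => ?_⟩
    rw [max_lt_iff] at hn
    rw [hWilf, hF, hg]
    exact Tail.wilf_pos hd (Tail.Split.of_gcd hd.pos n) hn.1 hm hn.2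
end

section
/- For every integer n > W·R², the sets of pseudo-Frobenius numbers PF(P_n) and PF(P_{n+r_k}) have the same (finite) cardinality; in particular, the type function n ↦ t(P_n) satisfies t(P_n) = t(P_{n+r_k}) for all n > W·R². -/
open Finset

section WeightedSemigroup

variable {ι : Type*} [Fintype ι]

/-- A maximal chain of vectors from `0` up to `y`, indexed by coordinate sum. -/
lemma exists_monotone_chain (y : ι → ℕ) :
    ∃ c : ℕ → ι → ℕ, Monotone c ∧ (∀ j, c j ≤ y) ∧ ∀ j ≤ ∑ i, y i, ∑ i, c j i = j := by
  classical
  induction h : ∑ i, y i generalizing y with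
  | zero => exact ⟨fun _ => 0, monotone_const, fun _ _ => Nat.zero_le _, by simp⟩
  | succ p ih =>
    obtain ⟨i₀, hi₀⟩ : ∃ i, y i ≠ 0 := by
      by_contra! h0
      simp [h0] at h
    set e : ι → ℕ := Pi.single i₀ 1 with he
    have hle : e ≤ y := by
      intro i
      by_cases hi : i = i₀
      · subst hi; simp [he]; omega
      · simp [he, hi]
    have hsum : ∑ i, (y - e) i + 1 = ∑ i, y i := by
      have : ∑ i, e i = 1 := by simp [he]
      rw [← this, ← sum_add_distrib]
      exact sum_congr rfl fun i _ => Nat.sub_add_cancel (hle i)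
    obtain ⟨c, hc, hcy, hcs⟩ := ih (y - e) (by omega)
    refine ⟨fun j => if j ≤ p then c j else y, ?_, ?_, ?_⟩
    · intro a b hab
      by_cases hb : b ≤ p
      · simpa [hb, hab.trans hb] using hc hab
      · by_cases ha : a ≤ p
        · simpa [ha, hb] using (hcy a).trans (fun i => Nat.sub_le _ _)
        · simp [ha, hb]
    · intro j
      by_cases hj : j ≤ p
      · simpa [hj] using (hcy j).trans (fun i => Nat.sub_le _ _)
      · simp [hj]
    · intro j hj
      by_cases hj' : j ≤ p
      · simpa [hj'] using hcs j hj'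
      · simp only [hj', if_false, h]; omega

lemma exists_le_dvd_sum (r y : ι → ℕ) {q : ℕ} (hq : 0 < q) (hy : q ≤ ∑ i, y i) :
    ∃ u ≤ y, 0 < ∑ i, u i ∧ q ∣ ∑ i, u i * r i := by
  obtain ⟨c, hc, hcy, hcs⟩ := exists_monotone_chain y
  obtain ⟨a, ha, b, hb, hab, hmod⟩ := exists_ne_map_eq_of_card_lt_of_maps_to
    (s := range (q + 1)) (t := range q) (f := fun j => (∑ i, c j i * r i) % q) (by simp)
    (fun j _ => by simpa using Nat.mod_lt _ hq)
  wlog hlt : a < b generalizing a b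
  · exact this b hb a ha hab.symm hmod.symm (by omega)
  simp only [mem_range] at ha hb
  have hsplit : ∀ i, c b i = (c b - c a) i + c a i :=
    fun i => (Nat.sub_add_cancel (hc hlt.le i)).symm
  refine ⟨c b - c a, fun i => (Nat.sub_le _ _).trans (hcy b i), ?_, ?_⟩
  · have h1 := hcs a (by omega)
    have h2 := hcs b (by omega)
    rw [sum_congr rfl fun i _ => hsplit i, sum_add_distrib] at h2
    omega
  · have h2 : ∑ i, c b i * r i = ∑ i, (c b - c a) i * r i + ∑ i, c a i * r i := by
      rw [← sum_add_distrib]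
      exact sum_congr rfl fun i _ => by rw [← add_mul, ← hsplit i]
    have h3 := (Nat.modEq_iff_dvd' (n := q) (by omega)).1 hmod
    rwa [h2, Nat.add_sub_cancel] at h3

/-- Every factorization can be rewritten, without increasing the weight, so that fewer than `r k`
generators are used besides copies of the generator `k` of largest ratio `r k / w k`. -/
lemma exists_reduced_factorization (w r : ι → ℕ) (k : ι) (hk : 0 < r k)
    (hratio : ∀ i, r i * w k ≤ r k * w i) (y : ι → ℕ) :
    ∃ (u : ι → ℕ) (c : ℕ), ∑ i, u i < r k ∧ ∑ i, u i * r i + c * r k = ∑ i, y i * r i ∧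
      ∑ i, u i * w i + c * w k ≤ ∑ i, y i * w i := by
  induction h : ∑ i, y i using Nat.strong_induction_on generalizing y with
  | _ p ih =>
  by_cases hp : p < r k
  · exact ⟨y, 0, by omega, by simp, by simp⟩
  obtain ⟨u, huy, hu, q, hq⟩ := exists_le_dvd_sum r y hk (by omega)
  have hsplit : ∀ i, y i = (y - u) i + u i := fun i => (Nat.sub_add_cancel (huy i)).symm
  have hsum (f : ι → ℕ) : ∑ i, y i * f i = ∑ i, (y - u) i * f i + ∑ i, u i * f i := by
    rw [← sum_add_distrib]
    exact sum_congr rfl fun i _ => by rw [← add_mul, ← hsplit i]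
  have hone := hsum 1
  simp only [Pi.one_apply, mul_one] at hone
  obtain ⟨v, c, hv, hvr, hvw⟩ := ih _ (by omega) (y - u) rfl
  refine ⟨v, c + q, hv, ?_, ?_⟩
  · rw [hsum r, hq, ← hvr]; ring
  · have hqw : q * w k ≤ ∑ i, u i * w i := by
      refine Nat.le_of_mul_le_mul_left ?_ hk
      calc r k * (q * w k) = (∑ i, u i * r i) * w k := by rw [hq]; ring
        _ = ∑ i, u i * (r i * w k) := by rw [sum_mul]; simp only [mul_assoc]
        _ ≤ ∑ i, u i * (r k * w i) := sum_le_sum fun i _ => Nat.mul_le_mul_left _ (hratio i)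
        _ = r k * ∑ i, u i * w i := by rw [mul_sum]; exact sum_congr rfl fun i _ => by ring
    rw [hsum w]
    nlinarith

/-- The submonoid of `ℕ` generated by the values of `r`. -/
def spanNat (r : ι → ℕ) : AddSubmonoid ℕ where
  carrier := {s | ∃ z : ι → ℕ, ∑ i, z i * r i = s}
  zero_mem' := ⟨0, by simp⟩
  add_mem' := by
    rintro _ _ ⟨y, rfl⟩ ⟨z, rfl⟩
    exact ⟨y + z, by simp [add_mul, sum_add_distrib]⟩

lemma apply_mem_spanNat (r : ι → ℕ) (i : ι) : r i ∈ spanNat r := by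
  classical
  exact ⟨Pi.single i 1, by simp [Pi.single_apply]⟩

/-- The least weight of a factorization of `s` into generators `r i` of weight `w i`. -/
noncomputable def minWeight (w r : ι → ℕ) (s : ℕ) : ℕ :=
  sInf {a | ∃ z : ι → ℕ, ∑ i, z i * r i = s ∧ ∑ i, z i * w i = a}

lemma minWeight_le (w r z : ι → ℕ) : minWeight w r (∑ i, z i * r i) ≤ ∑ i, z i * w i :=
  Nat.sInf_le ⟨z, rfl, rfl⟩

lemma exists_minWeight (w : ι → ℕ) {r : ι → ℕ} {s : ℕ} (hs : s ∈ spanNat r) :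
    ∃ z : ι → ℕ, ∑ i, z i * r i = s ∧ ∑ i, z i * w i = minWeight w r s := by
  obtain ⟨z, hz⟩ := hs
  exact Nat.sInf_mem (s := {a | ∃ z : ι → ℕ, ∑ i, z i * r i = s ∧ ∑ i, z i * w i = a})
    ⟨_, z, hz, rfl⟩

lemma minWeight_add_le (w : ι → ℕ) {r : ι → ℕ} {s t : ℕ} (hs : s ∈ spanNat r)
    (ht : t ∈ spanNat r) : minWeight w r (s + t) ≤ minWeight w r s + minWeight w r t := by
  obtain ⟨y, rfl, hy⟩ := exists_minWeight w hs
  obtain ⟨z, rfl, hz⟩ := exists_minWeight w ht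
  have := minWeight_le w r (y + z)
  simp only [Pi.add_apply, add_mul, sum_add_distrib] at this
  omega

lemma minWeight_apply_le (w r : ι → ℕ) (i : ι) : minWeight w r (r i) ≤ w i := by
  classical
  simpa [Pi.single_apply] using minWeight_le w r (Pi.single i 1)

lemma minWeight_add_apply_le (w : ι → ℕ) {r : ι → ℕ} {s : ℕ} (hs : s ∈ spanNat r) (i : ι) :
    minWeight w r (s + r i) ≤ minWeight w r s + w i :=
  (minWeight_add_le w hs (apply_mem_spanNat r i)).trans
    (Nat.add_le_add_left (minWeight_apply_le w r i) _)

lemma minWeight_pos {w r : ι → ℕ} (hw : ∀ i, 1 ≤ w i) {s : ℕ} (hs : s ∈ spanNat r)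
    (h0 : s ≠ 0) : 0 < minWeight w r s := by
  obtain ⟨z, rfl, hz⟩ := exists_minWeight w hs
  rw [← hz]
  obtain ⟨i, hi, hne⟩ := exists_ne_zero_of_sum_ne_zero h0
  refine sum_pos' (fun _ _ => Nat.zero_le _) ⟨i, hi, Nat.mul_pos ?_ (hw i)⟩
  exact Nat.pos_of_ne_zero (left_ne_zero_of_mul hne)

lemma mul_le_mul_minWeight {w r : ι → ℕ} {k : ι} (hratio : ∀ i, r i * w k ≤ r k * w i) {s : ℕ}
    (hs : s ∈ spanNat r) : s * w k ≤ r k * minWeight w r s := by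
  obtain ⟨z, rfl, hz⟩ := exists_minWeight w hs
  rw [← hz, sum_mul, mul_sum]
  refine sum_le_sum fun i _ => ?_
  calc z i * r i * w k = z i * (r i * w k) := by ring
    _ ≤ z i * (r k * w i) := Nat.mul_le_mul_left _ (hratio i)
    _ = r k * (z i * w i) := by ring

lemma sum_mul_le_of_sum_lt {u f : ι → ℕ} {q F : ℕ} (hu : ∑ i, u i < q) (hf : ∀ i, f i ≤ F) :
    ∑ i, u i * f i ≤ (q - 1) * F :=
  calc ∑ i, u i * f i ≤ ∑ i, u i * F := sum_le_sum fun i _ => Nat.mul_le_mul_left _ (hf i)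
    _ = (∑ i, u i) * F := by rw [sum_mul]
    _ ≤ (q - 1) * F := Nat.mul_le_mul_right _ (by omega)

lemma mul_minWeight_le {w r : ι → ℕ} {k : ι} (hk : 0 < r k)
    (hratio : ∀ i, r i * w k ≤ r k * w i) {W : ℕ} (hW : ∀ i, w i ≤ W) {s : ℕ}
    (hs : s ∈ spanNat r) : r k * minWeight w r s ≤ r k * ((r k - 1) * W) + s * w k := by
  classical
  obtain ⟨z, rfl⟩ := hs
  obtain ⟨u, c, hu, hval, -⟩ := exists_reduced_factorization w r k hk hratio z
  have hle : minWeight w r (∑ i, z i * r i) ≤ ∑ i, u i * w i + c * w k := by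
    have := minWeight_le w r (u + Pi.single k c)
    simpa [add_mul, sum_add_distrib, Pi.single_apply, hval] using this
  have hwt := sum_mul_le_of_sum_lt hu hW
  have hc : c * r k ≤ ∑ i, z i * r i := by omega
  calc r k * minWeight w r (∑ i, z i * r i) ≤ r k * ((r k - 1) * W + c * w k) :=
        Nat.mul_le_mul_left _ (by omega)
    _ = r k * ((r k - 1) * W) + (c * r k) * w k := by ring
    _ ≤ _ := Nat.add_le_add_left (Nat.mul_le_mul_right _ hc) _

lemma minWeight_lt_minWeight_add {w r : ι → ℕ} {k : ι} (hk : 0 < r k)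
    (hratio : ∀ i, r i * w k ≤ r k * w i) (hwk : 1 ≤ w k) {W R : ℕ} (hW : ∀ i, w i ≤ W)
    (hR : ∀ i, r i ≤ R) {s y : ℕ} (hy : W * R ^ 2 < y) (hs : s ∈ spanNat r)
    (hsy : s + y ∈ spanNat r) : minWeight w r s < minWeight w r (s + y) := by
  refine Nat.lt_of_mul_lt_mul_left (a := r k) ?_
  have h1 : r k * ((r k - 1) * W) ≤ W * R ^ 2 :=
    calc r k * ((r k - 1) * W) ≤ R * (R * W) :=
          Nat.mul_le_mul (hR k) (Nat.mul_le_mul_right _ ((Nat.sub_le _ _).trans (hR k)))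
      _ = W * R ^ 2 := by ring
  have h2 : y ≤ y * w k := Nat.le_mul_of_pos_right _ hwk
  calc r k * minWeight w r s ≤ r k * ((r k - 1) * W) + s * w k :=
        mul_minWeight_le hk hratio hW hs
    _ < (s + y) * w k := by rw [add_mul]; omega
    _ ≤ _ := mul_le_mul_minWeight hratio hsy

lemma mem_spanNat_and_minWeight_of_add_apply_mem {w r : ι → ℕ} {k : ι} (hk : 0 < r k)
    (hratio : ∀ i, r i * w k ≤ r k * w i) {R : ℕ} (hR : ∀ i, r i ≤ R) {s : ℕ}
    (hs : s + r k ∈ spanNat r) (hlarge : (r k - 1) * R < s + r k) :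
    s ∈ spanNat r ∧ minWeight w r (s + r k) = minWeight w r s + w k := by
  classical
  obtain ⟨z, hz, hzw⟩ := exists_minWeight w hs
  obtain ⟨u, c, hu, hval, hwt⟩ := exists_reduced_factorization w r k hk hratio z
  have hru := sum_mul_le_of_sum_lt hu hR
  obtain _ | c := c
  · omega
  have hsval : ∑ i, (u + Pi.single k c : ι → ℕ) i * r i = s := by
    simp only [Pi.add_apply, add_mul, sum_add_distrib, Pi.single_apply, ite_mul, zero_mul,
      sum_ite_eq', mem_univ, if_true]
    rw [add_mul] at hval
    omega
  have hsmem : s ∈ spanNat r := ⟨_, hsval⟩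
  refine ⟨hsmem, (minWeight_add_apply_le w hsmem k).antisymm ?_⟩
  have := minWeight_le w r (u + Pi.single k c)
  rw [hsval] at this
  simp only [Pi.add_apply, add_mul, sum_add_distrib, Pi.single_apply, ite_mul, zero_mul,
      sum_ite_eq', mem_univ, if_true] at this
  rw [add_mul] at hwt
  omega

lemma add_mul_mem_spanNat_iff {w r : ι → ℕ} {k : ι} (hk : 0 < r k)
    (hratio : ∀ i, r i * w k ≤ r k * w i) {R : ℕ} (hR : ∀ i, r i ≤ R) {s : ℕ}
    (hlarge : (r k - 1) * R < s + r k) (j : ℕ) :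
    s + j * r k ∈ spanNat r ↔ s ∈ spanNat r := by
  refine ⟨fun h => ?_, fun h => add_mem h ?_⟩
  · induction j with
    | zero => simpa using h
    | succ j ih =>
      rw [add_mul, one_mul, ← add_assoc] at h
      exact ih (mem_spanNat_and_minWeight_of_add_apply_mem hk hratio hR h (by omega)).1
  · simpa using nsmul_mem (apply_mem_spanNat r k) j

lemma minWeight_add_mul {w r : ι → ℕ} {k : ι} (hk : 0 < r k)
    (hratio : ∀ i, r i * w k ≤ r k * w i) {R : ℕ} (hR : ∀ i, r i ≤ R) {s : ℕ}
    (hs : s ∈ spanNat r) (hlarge : (r k - 1) * R < s + r k) (j : ℕ) :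
    minWeight w r (s + j * r k) = minWeight w r s + j * w k := by
  induction j with
  | zero => simp
  | succ j ih =>
    have hmem : s + j * r k + r k ∈ spanNat r := by
      have := (add_mul_mem_spanNat_iff hk hratio hR hlarge (j + 1)).2 hs
      rwa [add_mul, one_mul, ← add_assoc] at this
    have := (mem_spanNat_and_minWeight_of_add_apply_mem hk hratio hR hmem (by omega)).2
    rw [add_mul, one_mul, ← add_assoc, this, ih]
    ring

/-- `x` is a difference of two elements of `spanNat r`. -/
def IsDiff (r : ι → ℕ) (x : ℕ) : Prop := ∃ t ∈ spanNat r, t + x ∈ spanNat r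

lemma IsDiff.of_add {r : ι → ℕ} {x y : ℕ} (hx : IsDiff r x) (hxy : IsDiff r (x + y)) :
    IsDiff r y := by
  obtain ⟨t, ht, htx⟩ := hx
  obtain ⟨u, hu, hux⟩ := hxy
  refine ⟨u + (t + x), add_mem hu htx, ?_⟩
  convert add_mem hux ht using 1
  ring

lemma IsDiff.add_of_mem {r : ι → ℕ} {x s : ℕ} (hx : IsDiff r x) (hs : s ∈ spanNat r) :
    IsDiff r (x + s) := by
  obtain ⟨t, ht, htx⟩ := hx
  exact ⟨t, ht, by rw [← add_assoc]; exact add_mem htx hs⟩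

lemma IsDiff.mem_spanNat {w r : ι → ℕ} {k : ι} (hk : 0 < r k)
    (hratio : ∀ i, r i * w k ≤ r k * w i) {R : ℕ} (hR : ∀ i, r i ≤ R) {x : ℕ}
    (hx : IsDiff r x) (hlarge : (r k - 1) * R < x + r k) : x ∈ spanNat r := by
  obtain ⟨t, ht, htx⟩ := hx
  refine (add_mul_mem_spanNat_iff hk hratio hR hlarge t).1 ?_
  obtain ⟨q, hq⟩ := Nat.exists_eq_add_of_lt hk
  have : x + t * r k = (t + x) + q * t := by rw [hq]; ring
  rw [this]
  exact add_mem htx (by simpa using nsmul_mem ht q)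

/-- If `j * n` is the least positive multiple of `n` that is a difference of elements of
`spanNat r`, then the reduction of an element of `spanNat r` modulo `n` within `spanNat r`
amounts to the subtraction of `j * n`. -/
lemma exists_add_mul_eq_iff {w r : ι → ℕ} {k : ι} (hk : 0 < r k)
    (hratio : ∀ i, r i * w k ≤ r k * w i) {R : ℕ} (hR : ∀ i, r i ≤ R) {n j : ℕ}
    (hn : (r k - 1) * R < n) (hj : 0 < j) (hjn : IsDiff r (j * n))
    (hmin : ∀ i, 0 < i → IsDiff r (i * n) → j ≤ i) {s : ℕ} (hs : s ∈ spanNat r) :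
    (∃ t ∈ spanNat r, ∃ i, 0 < i ∧ t + i * n = s) ↔ ∃ t ∈ spanNat r, t + j * n = s := by
  refine ⟨?_, fun ⟨t, ht, h⟩ => ⟨t, ht, j, hj, h⟩⟩
  rintro ⟨t, ht, i, hi, rfl⟩
  have hin : IsDiff r (i * n) := ⟨t, ht, hs⟩
  obtain ⟨l, rfl⟩ := Nat.exists_eq_add_of_le (hmin i hi hin)
  refine ⟨t + l * n, add_mem ht ?_, by ring⟩
  obtain rfl | hl := Nat.eq_zero_or_pos l
  · simp
  rw [add_mul] at hin
  have : n ≤ l * n := Nat.le_mul_of_pos_left _ hl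
  exact (hjn.of_add hin).mem_spanNat hk hratio hR (by omega)

/-- The elements `s` of `spanNat r` with `s - N ∉ spanNat r` such that each `s + r i` either can be
lowered by `N` within `spanNat r` or has weight less than `minWeight w r s + w i`. -/
def maximalSet (w r : ι → ℕ) (N : ℕ) : Set ℕ :=
  {s | s ∈ spanNat r ∧ (¬ ∃ t ∈ spanNat r, t + N = s) ∧
    ∀ i, (∃ t ∈ spanNat r, t + N = s + r i) ∨ minWeight w r (s + r i) < minWeight w r s + w i}

lemma exists_add_eq_of_mem_maximalSet {w r : ι → ℕ} {k : ι} (hk : 0 < r k)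
    (hratio : ∀ i, r i * w k ≤ r k * w i) {R : ℕ} (hR : ∀ i, r i ≤ R) {N s : ℕ}
    (hs : s ∈ maximalSet w r N) (hlarge : (r k - 1) * R < s + r k) :
    ∃ t ∈ spanNat r, t + N = s + r k := by
  refine (hs.2.2 k).resolve_right ?_
  have := minWeight_add_mul hk hratio hR hs.1 hlarge 1
  rw [one_mul, one_mul] at this
  omega

lemma maximalSet_finite {w r : ι → ℕ} {k : ι} (hk : 0 < r k)
    (hratio : ∀ i, r i * w k ≤ r k * w i) {R : ℕ} (hR : ∀ i, r i ≤ R) (N : ℕ) :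
    (maximalSet w r N).Finite := by
  refine (Set.finite_Iic ((r k - 1) * R + N)).subset fun s hs => ?_
  by_contra hlt
  simp only [Set.mem_Iic, not_le] at hlt
  obtain ⟨t, ht, hts⟩ := exists_add_eq_of_mem_maximalSet hk hratio hR hs (by omega)
  obtain ⟨u, rfl⟩ := Nat.exists_eq_add_of_le' (show r k ≤ t by omega)
  exact hs.2.1 ⟨u, (mem_spanNat_and_minWeight_of_add_apply_mem hk hratio hR ht (by omega)).1,
    by omega⟩

lemma mem_maximalSet_congr_of_small {w r : ι → ℕ} {N M s : ℕ} (hN : ∀ i, s + r i < N)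
    (hs : s < N) (hNM : N ≤ M) : s ∈ maximalSet w r M ↔ s ∈ maximalSet w r N := by
  have h1 (L : ℕ) (hL : N ≤ L) : ¬ ∃ t ∈ spanNat r, t + L = s := fun ⟨t, _, h⟩ => by omega
  have h2 (L : ℕ) (hL : N ≤ L) (i : ι) : ¬ ∃ t ∈ spanNat r, t + L = s + r i :=
    fun ⟨t, _, h⟩ => by have := hN i; omega
  simp only [maximalSet, Set.mem_ofPred_eq, h1 N le_rfl, h1 M hNM, h2 N le_rfl, h2 M hNM]

lemma add_mem_maximalSet_iff {w r : ι → ℕ} {k : ι} (hk : 0 < r k)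
    (hratio : ∀ i, r i * w k ≤ r k * w i) {R : ℕ} (hR : ∀ i, r i ≤ R) {N s : ℕ}
    (hlarge : (r k - 1) * R < s + r k) (j : ℕ) :
    s + j * r k ∈ maximalSet w r (N + j * r k) ↔ s ∈ maximalSet w r N := by
  have hsub (x : ℕ) : (∃ t ∈ spanNat r, t + (N + j * r k) = x + j * r k) ↔
      ∃ t ∈ spanNat r, t + N = x :=
    exists_congr fun t => and_congr_right' (by omega)
  unfold maximalSet
  simp only [Set.mem_ofPred_eq, add_mul_mem_spanNat_iff hk hratio hR hlarge j]
  refine and_congr_right fun hs => and_congr (not_congr (hsub s)) (forall_congr' fun i => ?_)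
  rw [add_right_comm s, hsub, minWeight_add_mul hk hratio hR hs hlarge,
    minWeight_add_mul hk hratio hR (add_mem hs (apply_mem_spanNat r i)) (by omega)]
  exact or_congr_right (by omega)

lemma maximalSet_add_eq_image {w r : ι → ℕ} {k : ι} (hk : 0 < r k)
    (hratio : ∀ i, r i * w k ≤ r k * w i) {R : ℕ} (hR : ∀ i, r i ≤ R) {N : ℕ}
    (hN : (r k - 1) * R + R < N) (j : ℕ) :
    maximalSet w r (N + j * r k) =
      (fun s => if s + r k ≤ (r k - 1) * R then s else s + j * r k) '' maximalSet w r N := by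
  have hsmall (s : ℕ) (hs : s + r k ≤ (r k - 1) * R) :
      s ∈ maximalSet w r (N + j * r k) ↔ s ∈ maximalSet w r N :=
    mem_maximalSet_congr_of_small (fun i => by have := hR i; omega) (by omega) (by omega)
  ext s
  constructor
  · intro h
    by_cases hs : s + r k ≤ (r k - 1) * R
    · exact ⟨s, (hsmall s hs).1 h, by simp [hs]⟩
    · obtain ⟨t, -, hts⟩ := exists_add_eq_of_mem_maximalSet hk hratio hR h (by omega)
      have := hR k
      obtain ⟨u, rfl⟩ := Nat.exists_eq_add_of_le' (show j * r k ≤ s by omega)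
      refine ⟨u, (add_mem_maximalSet_iff hk hratio hR (by omega) j).1 h, ?_⟩
      have hu : ¬ u + r k ≤ (r k - 1) * R := by omega
      simp [hu]
  · rintro ⟨u, hu, rfl⟩
    by_cases hs : u + r k ≤ (r k - 1) * R
    · simpa [hs] using (hsmall u hs).2 hu
    · simpa [hs] using (add_mem_maximalSet_iff hk hratio hR (by omega) j).2 hu

lemma ncard_maximalSet_add {w r : ι → ℕ} {k : ι} (hk : 0 < r k)
    (hratio : ∀ i, r i * w k ≤ r k * w i) {R : ℕ} (hR : ∀ i, r i ≤ R) {N : ℕ}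
    (hN : (r k - 1) * R + R < N) (j : ℕ) :
    (maximalSet w r (N + j * r k)).ncard = (maximalSet w r N).ncard := by
  rw [maximalSet_add_eq_image hk hratio hR hN j]
  refine Set.ncard_image_of_injective _ fun a b hab => ?_
  split_ifs at hab <;> omega

/-- The submonoid of `ℕ` generated by `n` and the numbers `w i * n + r i`. -/
def shiftedSpan (w r : ι → ℕ) (n : ℕ) : Set ℕ :=
  {x | ∃ z₀ : ℕ, ∃ z : ι → ℕ, x = z₀ * n + ∑ i, z i * (w i * n + r i)}

/-- The pseudo-Frobenius numbers of a subset of `ℕ`. -/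
def pseudoFrobenius (T : Set ℕ) : Set ℕ := {x | x ∉ T ∧ ∀ t ∈ T, 0 < t → x + t ∈ T}

lemma mem_shiftedSpan_iff {w r : ι → ℕ} {n x : ℕ} :
    x ∈ shiftedSpan w r n ↔ ∃ s ∈ spanNat r, ∃ a, minWeight w r s ≤ a ∧ x = a * n + s := by
  have hsum (z : ι → ℕ) : ∑ i, z i * (w i * n + r i) = (∑ i, z i * w i) * n + ∑ i, z i * r i := by
    rw [sum_mul, ← sum_add_distrib]
    exact sum_congr rfl fun i _ => by ring
  constructor
  · rintro ⟨z₀, z, rfl⟩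
    refine ⟨_, ⟨z, rfl⟩, z₀ + ∑ i, z i * w i, (minWeight_le w r z).trans (by omega), ?_⟩
    rw [hsum]; ring
  · rintro ⟨s, hs, a, ha, rfl⟩
    obtain ⟨z, rfl, hz⟩ := exists_minWeight w hs
    obtain ⟨b, rfl⟩ := Nat.exists_eq_add_of_le' ha
    refine ⟨b, z, ?_⟩
    rw [hsum, hz]; ring

lemma add_mem_shiftedSpan {w r : ι → ℕ} {n x y : ℕ} (hx : x ∈ shiftedSpan w r n)
    (hy : y ∈ shiftedSpan w r n) : x + y ∈ shiftedSpan w r n := by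
  obtain ⟨a, y, rfl⟩ := hx
  obtain ⟨b, z, rfl⟩ := hy
  refine ⟨a + b, y + z, ?_⟩
  simp only [Pi.add_apply, add_mul, sum_add_distrib]
  ring

lemma self_mem_shiftedSpan (w r : ι → ℕ) (n : ℕ) : n ∈ shiftedSpan w r n :=
  ⟨1, 0, by simp⟩

lemma generator_mem_shiftedSpan (w r : ι → ℕ) (n : ℕ) (i : ι) :
    w i * n + r i ∈ shiftedSpan w r n := by
  classical
  exact ⟨0, Pi.single i 1, by simp [Pi.single_apply]⟩

lemma exists_generator_add_of_mem_shiftedSpan {w r : ι → ℕ} {n x : ℕ}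
    (hx : x ∈ shiftedSpan w r n) (h0 : 0 < x) :
    ∃ y ∈ shiftedSpan w r n, x = n + y ∨ ∃ i, x = w i * n + r i + y := by
  classical
  obtain ⟨z₀, z, rfl⟩ := hx
  obtain _ | a := z₀
  · obtain ⟨i, hi⟩ : ∃ i, z i ≠ 0 := by
      by_contra! h
      simp [h] at h0
    have hz : z = Function.update z i (z i - 1) + Pi.single i 1 := by
      ext l
      by_cases hl : l = i
      · subst hl; simp; omega
      · simp [hl]
    refine ⟨_, ⟨0, Function.update z i (z i - 1), rfl⟩, Or.inr ⟨i, ?_⟩⟩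
    conv_lhs => rw [hz]
    simp only [Pi.add_apply, add_mul, sum_add_distrib, Pi.single_apply, ite_mul, zero_mul,
      sum_ite_eq', mem_univ, if_true]
    ring
  · exact ⟨_, ⟨a, z, rfl⟩, Or.inl (by ring)⟩

lemma pseudoFrobenius_shiftedSpan_iff {w r : ι → ℕ} {n x : ℕ} (hn : 0 < n)
    (hpos : ∀ i, 0 < w i * n + r i) :
    x ∈ pseudoFrobenius (shiftedSpan w r n) ↔ x ∉ shiftedSpan w r n ∧
      x + n ∈ shiftedSpan w r n ∧ ∀ i, x + (w i * n + r i) ∈ shiftedSpan w r n := by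
  refine and_congr_right fun _ => ⟨fun h => ⟨h _ (self_mem_shiftedSpan w r n) hn,
    fun i => h _ (generator_mem_shiftedSpan w r n i) (hpos i)⟩, fun ⟨h1, h2⟩ t ht ht0 => ?_⟩
  obtain ⟨y, hy, rfl | ⟨i, rfl⟩⟩ := exists_generator_add_of_mem_shiftedSpan ht ht0
  · rw [← add_assoc]; exact add_mem_shiftedSpan h1 hy
  · rw [← add_assoc]; exact add_mem_shiftedSpan (h2 i) hy

/-- If adding at least `n` to an element of `spanNat r` increases its least weight, then an element
that cannot be lowered by a multiple of `n` is the optimal representative of its residue class. -/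
lemma mul_add_mem_shiftedSpan_iff {w r : ι → ℕ} {n : ℕ}
    (hlt : ∀ s y, n ≤ y → s ∈ spanNat r → s + y ∈ spanNat r →
      minWeight w r s < minWeight w r (s + y)) {s : ℕ} (hs : s ∈ spanNat r)
    (hmin : ¬ ∃ t ∈ spanNat r, ∃ i, 0 < i ∧ t + i * n = s) (a : ℕ) :
    a * n + s ∈ shiftedSpan w r n ↔ minWeight w r s ≤ a := by
  rw [mem_shiftedSpan_iff]
  refine ⟨?_, fun h => ⟨s, hs, a, h, rfl⟩⟩
  rintro ⟨t, ht, b, hb, hab⟩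
  rcases lt_trichotomy a b with h | rfl | h
  · obtain ⟨c, rfl⟩ := Nat.exists_eq_add_of_lt h
    exact absurd ⟨t, ht, c + 1, by omega, by linarith⟩ hmin
  · obtain rfl : s = t := by omega
    exact hb
  · obtain ⟨c, rfl⟩ := Nat.exists_eq_add_of_lt h
    have hst : t = s + (c + 1) * n := by linarith
    rw [hst] at ht hb
    have := hlt s ((c + 1) * n) (Nat.le_mul_of_pos_left n (Nat.succ_pos c)) hs ht
    omega

lemma pseudoFrobenius_shiftedSpan_eq_image {w r : ι → ℕ} {n N : ℕ} (hn : 0 < n)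
    (hw : ∀ i, 1 ≤ w i)
    (hlt : ∀ s y, n ≤ y → s ∈ spanNat r → s + y ∈ spanNat r →
      minWeight w r s < minWeight w r (s + y))
    (hN : ∀ s ∈ spanNat r, (∃ t ∈ spanNat r, ∃ i, 0 < i ∧ t + i * n = s) ↔
      ∃ t ∈ spanNat r, t + N = s)
    (h0 : 0 ∉ maximalSet w r N) :
    pseudoFrobenius (shiftedSpan w r n) =
      (fun s => (minWeight w r s - 1) * n + s) '' maximalSet w r N := by
  have hlt' (t i : ℕ) (hi : 0 < i) (ht : t ∈ spanNat r) (hti : t + i * n ∈ spanNat r) :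
      minWeight w r t < minWeight w r (t + i * n) :=
    hlt t _ (Nat.le_mul_of_pos_left n hi) ht hti
  have hpos (i : ι) : 0 < w i * n + r i := Nat.add_pos_left (Nat.mul_pos (hw i) hn) _
  ext x
  rw [pseudoFrobenius_shiftedSpan_iff hn hpos]
  constructor
  · rintro ⟨hx, hxn, hxi⟩
    obtain ⟨s, hs, a, ha, hxa⟩ := mem_shiftedSpan_iff.1 hxn
    obtain _ | a := a
    · have : s ≠ 0 := by omega
      have := minWeight_pos hw hs this
      omega
    obtain rfl : x = a * n + s := by linarith
    have hsa : minWeight w r s = a + 1 := by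
      refine ha.antisymm (Nat.lt_of_not_le fun h => hx ?_)
      exact mem_shiftedSpan_iff.2 ⟨s, hs, a, h, rfl⟩
    have hmin : ¬ ∃ t ∈ spanNat r, ∃ i, 0 < i ∧ t + i * n = s := by
      rintro ⟨t, ht, i, hi, rfl⟩
      have := hlt' t i hi ht hs
      exact hx (mem_shiftedSpan_iff.2 ⟨t, ht, a + i, by omega, by ring⟩)
    refine ⟨s, ⟨hs, fun h => hmin ((hN s hs).2 h), fun i => ?_⟩, by simp [hsa]⟩
    have hsi := add_mem hs (apply_mem_spanNat r i)
    rw [← hN _ hsi]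
    refine or_iff_not_imp_left.2 fun h => ?_
    have hmem := hxi i
    rw [show a * n + s + (w i * n + r i) = (a + w i) * n + (s + r i) by ring,
      mul_add_mem_shiftedSpan_iff hlt hsi h] at hmem
    omega
  · rintro ⟨s, hsN, rfl⟩
    obtain ⟨hs, hmin, hi⟩ := hsN
    have hsne : s ≠ 0 := by rintro rfl; exact h0 ⟨hs, hmin, hi⟩
    obtain ⟨a, ha⟩ := Nat.exists_eq_add_of_lt (minWeight_pos hw hs hsne)
    simp only [zero_add] at ha
    simp only [ha, Nat.add_sub_cancel]
    refine ⟨?_, ?_, fun i => ?_⟩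
    · rw [mul_add_mem_shiftedSpan_iff hlt hs (mt (hN s hs).1 hmin)]
      omega
    · exact mem_shiftedSpan_iff.2 ⟨s, hs, a + 1, ha.le, by ring⟩
    · have hsi := add_mem hs (apply_mem_spanNat r i)
      have hle := minWeight_add_apply_le w hs i
      rw [show a * n + s + (w i * n + r i) = (a + w i) * n + (s + r i) by ring]
      rcases hi i with h | h
      · obtain ⟨t, ht, l, hl, htl⟩ := (hN _ hsi).2 h
        have := hlt' t l hl ht (htl ▸ hsi)
        rw [htl] at this
        exact mem_shiftedSpan_iff.2 ⟨t, ht, a + w i + l, by omega, by rw [← htl]; ring⟩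
      · exact mem_shiftedSpan_iff.2 ⟨s + r i, hsi, a + w i, by omega, rfl⟩

lemma injOn_maximalSet {w r : ι → ℕ} {n N : ℕ}
    (hN : ∀ s ∈ spanNat r, (∃ t ∈ spanNat r, ∃ i, 0 < i ∧ t + i * n = s) ↔
      ∃ t ∈ spanNat r, t + N = s) :
    Set.InjOn (fun s => (minWeight w r s - 1) * n + s) (maximalSet w r N) := by
  intro s hs t ht hst
  simp only at hst
  wlog hle : minWeight w r s - 1 ≤ minWeight w r t - 1 generalizing s t
  · exact (this ht hs hst.symm (by omega)).symm
  obtain ⟨c, hc⟩ := Nat.exists_eq_add_of_le hle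
  obtain rfl | hc0 := Nat.eq_zero_or_pos c
  · rw [hc] at hst; simpa using hst
  · rw [hc, add_mul] at hst
    exact absurd ((hN s hs.1).1 ⟨t, ht.1, c, hc0, by omega⟩) hs.2.1

lemma zero_notMem_maximalSet {w r : ι → ℕ} {k : ι} (hk : 0 < r k)
    (hratio : ∀ i, r i * w k ≤ r k * w i) {N : ℕ} (hN : r k < N) : 0 ∉ maximalSet w r N := by
  rintro ⟨-, -, h⟩
  have hzero : minWeight w r 0 = 0 := by simpa using minWeight_le w r 0
  have hge := Nat.le_of_mul_le_mul_left
    (mul_le_mul_minWeight (w := w) hratio (apply_mem_spanNat r k)) hk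
  rcases h k with ⟨t, -, ht⟩ | h
  · omega
  · rw [zero_add, hzero] at h
    omega

/-- The type of the shifted semigroup, counted by `maximalSet`. -/
lemma pseudoFrobenius_finite_and_ncard {w r : ι → ℕ} {k : ι} (hk : 0 < r k)
    (hratio : ∀ i, r i * w k ≤ r k * w i) (hw : ∀ i, 1 ≤ w i) {W R : ℕ} (hW : ∀ i, w i ≤ W)
    (hR : ∀ i, r i ≤ R) {n j : ℕ} (hn : W * R ^ 2 < n) (hj : 0 < j) (hjn : IsDiff r (j * n))
    (hmin : ∀ i, 0 < i → IsDiff r (i * n) → j ≤ i) :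
    (pseudoFrobenius (shiftedSpan w r n)).Finite ∧
      (pseudoFrobenius (shiftedSpan w r n)).ncard = (maximalSet w r (j * n)).ncard := by
  have hRn : r k * R < n := lt_of_le_of_lt
    (calc r k * R ≤ 1 * R ^ 2 := by rw [one_mul, sq]; exact Nat.mul_le_mul_right _ (hR k)
      _ ≤ W * R ^ 2 := Nat.mul_le_mul_right _ ((hw k).trans (hW k))) hn
  have hRpos : 0 < R := hk.trans_le (hR k)
  have hrn : r k < n := (Nat.le_mul_of_pos_right _ hRpos).trans_lt hRn
  have hlt (s y : ℕ) (hy : n ≤ y) (hs : s ∈ spanNat r) (hsy : s + y ∈ spanNat r) :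
      minWeight w r s < minWeight w r (s + y) :=
    minWeight_lt_minWeight_add hk hratio (hw k) hW hR (by omega) hs hsy
  have hN (s : ℕ) (hs : s ∈ spanNat r) := exists_add_mul_eq_iff hk hratio hR
    ((Nat.mul_le_mul_right R (Nat.sub_le (r k) 1)).trans_lt hRn) hj hjn hmin hs
  rw [pseudoFrobenius_shiftedSpan_eq_image (by omega) hw hlt hN
    (zero_notMem_maximalSet hk hratio (hrn.trans_le (Nat.le_mul_of_pos_left n hj)))]
  exact ⟨(maximalSet_finite hk hratio hR _).image _, (injOn_maximalSet hN).ncard_image⟩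

lemma isDiff_mul_add_iff (r : ι → ℕ) (k : ι) (i n : ℕ) :
    IsDiff r (i * (n + r k)) ↔ IsDiff r (i * n) := by
  have hmem : i * r k ∈ spanNat r := by simpa using nsmul_mem (apply_mem_spanNat r k) i
  rw [mul_add]
  refine ⟨fun h => ?_, fun h => h.add_of_mem hmem⟩
  rw [add_comm] at h
  exact IsDiff.of_add ⟨0, zero_mem _, by simpa using hmem⟩ h

theorem pseudoFrobenius_shiftedSpan_add {w r : ι → ℕ} {k : ι} (hk : 0 < r k)
    (hratio : ∀ i, r i * w k ≤ r k * w i) (hw : ∀ i, 1 ≤ w i) {W R : ℕ} (hW : ∀ i, w i ≤ W)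
    (hR : ∀ i, r i ≤ R) {n : ℕ} (hn : W * R ^ 2 < n) :
    (pseudoFrobenius (shiftedSpan w r n)).Finite ∧
      (pseudoFrobenius (shiftedSpan w r (n + r k))).Finite ∧
      (pseudoFrobenius (shiftedSpan w r n)).ncard =
        (pseudoFrobenius (shiftedSpan w r (n + r k))).ncard := by
  classical
  have hex : ∃ j, 0 < j ∧ IsDiff r (j * n) := by
    refine ⟨r k, hk, 0, zero_mem _, ?_⟩
    simpa [mul_comm] using nsmul_mem (apply_mem_spanNat r k) n
  obtain ⟨hj, hjn⟩ := Nat.find_spec hex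
  have hmin (i : ℕ) (hi : 0 < i) (h : IsDiff r (i * n)) : Nat.find hex ≤ i :=
    Nat.find_min' hex ⟨hi, h⟩
  generalize Nat.find hex = j at hj hjn hmin
  obtain ⟨hfin, hcard⟩ := pseudoFrobenius_finite_and_ncard hk hratio hw hW hR hn hj hjn hmin
  obtain ⟨hfin', hcard'⟩ := pseudoFrobenius_finite_and_ncard hk hratio hw hW hR
    (n := n + r k) (by omega) hj ((isDiff_mul_add_iff r k j n).2 hjn)
    fun i hi h => hmin i hi ((isDiff_mul_add_iff r k i n).1 h)
  refine ⟨hfin, hfin', ?_⟩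
  have hRR : (r k - 1) * R + R < j * n :=
    calc (r k - 1) * R + R = r k * R := by
          obtain ⟨q, hq⟩ := Nat.exists_eq_add_of_lt hk
          rw [hq]; simp; ring
      _ ≤ 1 * R ^ 2 := by rw [one_mul, sq]; exact Nat.mul_le_mul_right _ (hR k)
      _ ≤ W * R ^ 2 := Nat.mul_le_mul_right _ ((hw k).trans (hW k))
      _ < n := hn
      _ ≤ j * n := Nat.le_mul_of_pos_left n hj
  rw [hcard, hcard', mul_add, ncard_maximalSet_add hk hratio hR hRR]

end WeightedSemigroup

/-- Corollary (the type of `P_n = ⟨n, w₂n+r₂,…,w_kn+r_k⟩` is eventually periodic):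
for `n > W·R²`, the sets of pseudo-Frobenius numbers `PF(P_n)` and `PF(P_{n+r_k})`
are finite and have equal cardinality, i.e. `t(P_n) = t(P_{n+r_k})`.
The tail generators are indexed by `Fin (m+1)`. -/
theorem stmt_18 (m : ℕ) (w r : Fin (m+1) → ℕ) (hw : ∀ i, 1 ≤ w i)
    (hrk : 1 ≤ r (Fin.last m))
    (hsort : ∀ i j : Fin (m+1), i ≤ j → (r i : ℚ) / (w i : ℚ) ≤ (r j : ℚ) / (w j : ℚ))
    (P : ℕ → Set ℕ)
    (hP : ∀ N : ℕ, P N = {x | ∃ z₀ : ℕ, ∃ z : Fin (m+1) → ℕ,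
      x = z₀ * N + ∑ i, z i * (w i * N + r i)})
    (W : ℕ) (hW : W = max 1 (Finset.univ.sup w))
    (R : ℕ) (hR : R = Finset.univ.sup r)
    (PF : Set ℕ → Set ℕ)
    (hPF : ∀ T : Set ℕ, PF T = {x | x ∉ T ∧ ∀ t ∈ T, 0 < t → x + t ∈ T})
    (n : ℕ) (hn : W * R ^ 2 < n) :
    (PF (P n)).Finite ∧ (PF (P (n + r (Fin.last m)))).Finite ∧
      (PF (P n)).ncard = (PF (P (n + r (Fin.last m)))).ncard := by
  have hwpos (i : Fin (m+1)) : (0 : ℚ) < w i := by exact_mod_cast hw i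
  have hratio (i : Fin (m+1)) : r i * w (Fin.last m) ≤ r (Fin.last m) * w i := by
    have h := hsort i (Fin.last m) (Fin.le_last i)
    rw [div_le_div_iff₀ (hwpos i) (hwpos _)] at h
    exact_mod_cast h
  obtain rfl : P = shiftedSpan w r := funext hP
  obtain rfl : PF = pseudoFrobenius := funext hPF
  refine pseudoFrobenius_shiftedSpan_add hrk hratio hw (fun i => ?_) (fun i => ?_) hn
  · rw [hW]
    exact (le_sup (f := w) (mem_univ i)).trans (le_max_right _ _)
  · rw [hR]
    exact le_sup (f := r) (mem_univ i)
end
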